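/- arXiv:2310.02788 — 3 statements merged into one kernel-verified Lean document; each statement's English description precedes it below -/
import Mathlib

section
/- Let K be a finite field extension of ℂ((x,y)), let n ≥ 1 be an integer, and let f ∈ K^×. If the set of places v of K (nonzero prime ideals of R) such that the image of f in the v-adic completion K_v is not an n-th power in K_v is finite, then it is empty; that is, if f is an n-th power in K_v for all but finitely many places v, then f is an n-th power in K_v for every place v. -/
instance : IsDomain (MvPowerSeries (Fin 2) ℂ) := NoZeroDivisors.to_isDomain _

namespace LinearMap

variable {k M N P : Type*} [Field k] [AddCommGroup M] [Module k M] [AddCommGroup N] [Module k N]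
  [AddCommGroup P] [Module k P]

/-- A linear map with finite-dimensional kernel and cokernel. -/
def HasIndex (φ : M →ₗ[k] N) : Prop :=
  FiniteDimensional k (ker φ) ∧ FiniteDimensional k (N ⧸ range φ)

/-- The dimension of the cokernel minus the dimension of the kernel. -/
noncomputable def coindex (φ : M →ₗ[k] N) : ℤ :=
  (Module.finrank k (N ⧸ range φ) : ℤ) - Module.finrank k (ker φ)

/-- The kernel of a composition, as an extension. -/
lemma finiteDimensional_ker_comp (φ : M →ₗ[k] N) (ψ : N →ₗ[k] P)
    [FiniteDimensional k (ker φ)] [FiniteDimensional k ↥(range φ ⊓ ker ψ)] :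
    FiniteDimensional k (ker (ψ ∘ₗ φ)) ∧
      Module.finrank k (ker (ψ ∘ₗ φ)) =
        Module.finrank k (ker φ) + Module.finrank k ↥(range φ ⊓ ker ψ) := by
  let f : ker (ψ ∘ₗ φ) →ₗ[k] N := φ ∘ₗ (ker (ψ ∘ₗ φ)).subtype
  have hr : range f = range φ ⊓ ker ψ := by
    ext y
    constructor
    · rintro ⟨⟨m, hm⟩, rfl⟩
      exact ⟨⟨m, rfl⟩, hm⟩
    · rintro ⟨⟨m, rfl⟩, hm⟩
      exact ⟨⟨m, hm⟩, rfl⟩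
  have hle : ker φ ≤ ker (ψ ∘ₗ φ) := ker_le_ker_comp φ ψ
  let eK : ker f ≃ₗ[k] ker φ :=
    LinearEquiv.ofBijective
      ((ker (ψ ∘ₗ φ)).subtype.restrict (p := ker f) (q := ker φ) fun z hz ↦ hz) <| by
      constructor
      · exact fun a b h ↦ Subtype.ext (Subtype.ext (by have := congrArg Subtype.val h; exact this))
      · rintro ⟨a, ha⟩
        exact ⟨⟨⟨a, hle ha⟩, ha⟩, rfl⟩
  have e2 : (ker (ψ ∘ₗ φ) ⧸ ker f) ≃ₗ[k] ↥(range φ ⊓ ker ψ) :=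
    f.quotKerEquivRange.trans (LinearEquiv.ofEq _ _ hr)
  have : FiniteDimensional k (ker f) := eK.symm.finiteDimensional
  have : FiniteDimensional k (ker (ψ ∘ₗ φ) ⧸ ker f) := e2.symm.finiteDimensional
  have hf : FiniteDimensional k (ker (ψ ∘ₗ φ)) := Module.Finite.of_submodule_quotient (ker f)
  refine ⟨hf, ?_⟩
  rw [← Submodule.finrank_quotient_add_finrank (ker f), e2.finrank_eq, eK.finrank_eq, add_comm]

/-- Dimensions in a chain of two subspaces. -/
lemma finrank_quotient_chain (S T : Submodule k M) (h : S ≤ T)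
    [FiniteDimensional k (M ⧸ S)] :
    Module.finrank k (M ⧸ S) =
      Module.finrank k (M ⧸ T) + Module.finrank k (T.map S.mkQ) := by
  rw [← Submodule.finrank_quotient_add_finrank (T.map S.mkQ),
    (Submodule.quotientQuotientEquivQuotient S T h).finrank_eq]

lemma HasIndex.comp {φ : M →ₗ[k] N} {ψ : N →ₗ[k] P} (hφ : φ.HasIndex) (hψ : ψ.HasIndex) :
    (ψ ∘ₗ φ).HasIndex ∧ (ψ ∘ₗ φ).coindex = ψ.coindex + φ.coindex := by
  obtain ⟨h1, h2⟩ := hφ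
  obtain ⟨h3, h4⟩ := hψ
  have h5 : FiniteDimensional k ↥(range φ ⊓ ker ψ) :=
    Submodule.finiteDimensional_of_le inf_le_right
  obtain ⟨h6, h7⟩ := finiteDimensional_ker_comp φ ψ
  let T : Submodule k N := range φ ⊔ ker ψ
  have hT : range φ ≤ T := le_sup_left
  have : FiniteDimensional k (N ⧸ T) :=
    Module.Finite.of_surjective (Submodule.factor hT) (Submodule.factor_surjective hT)
  have hR : range (ψ ∘ₗ φ) ≤ range ψ := range_comp_le_range φ ψ
  -- the middle piece of the cokernel
  have e1 : (N ⧸ T) ≃ₗ[k] (range ψ).map (range (ψ ∘ₗ φ)).mkQ := by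
    let f : N →ₗ[k] P ⧸ range (ψ ∘ₗ φ) := (range (ψ ∘ₗ φ)).mkQ ∘ₗ ψ
    have hk : ker f = T := by
      ext y
      simp only [f, mem_ker, comp_apply, Submodule.mkQ_apply, Submodule.Quotient.mk_eq_zero, T,
        Submodule.mem_sup, mem_range]
      constructor
      · rintro ⟨m, hm⟩
        exact ⟨φ m, ⟨m, rfl⟩, y - φ m, by simp [← hm], by abel⟩
      · rintro ⟨_, ⟨m, rfl⟩, z, hz, rfl⟩
        exact ⟨m, by simp [hz]⟩
    have hr : range f = (range ψ).map (range (ψ ∘ₗ φ)).mkQ := range_comp _ _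
    exact (Submodule.quotEquivOfEq _ _ hk.symm).trans
      (f.quotKerEquivRange.trans (LinearEquiv.ofEq _ _ hr))
  have e2 : ((P ⧸ range (ψ ∘ₗ φ)) ⧸ (range ψ).map (range (ψ ∘ₗ φ)).mkQ) ≃ₗ[k] P ⧸ range ψ :=
    Submodule.quotientQuotientEquivQuotient _ _ hR
  have : FiniteDimensional k ((range ψ).map (range (ψ ∘ₗ φ)).mkQ) := e1.finiteDimensional
  have : FiniteDimensional k ((P ⧸ range (ψ ∘ₗ φ)) ⧸ (range ψ).map (range (ψ ∘ₗ φ)).mkQ) :=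
    e2.symm.finiteDimensional
  have h8 : FiniteDimensional k (P ⧸ range (ψ ∘ₗ φ)) :=
    Module.Finite.of_submodule_quotient ((range ψ).map (range (ψ ∘ₗ φ)).mkQ)
  refine ⟨⟨h6, h8⟩, ?_⟩
  have h9 := finrank_quotient_chain _ _ hR
  have h10 := finrank_quotient_chain _ _ hT
  have e3 : (ker ψ ⧸ (range φ).submoduleOf (ker ψ)) ≃ₗ[k] T.map (range φ).mkQ := by
    let f : ker ψ →ₗ[k] N ⧸ range φ := (range φ).mkQ ∘ₗ (ker ψ).subtype
    have hk : ker f = (range φ).submoduleOf (ker ψ) := by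
      ext y
      simp [f, Submodule.submoduleOf]
    have hr : range f = T.map (range φ).mkQ := by
      rw [range_comp, Submodule.range_subtype, Submodule.map_sup]
      simp
    exact (Submodule.quotEquivOfEq _ _ hk.symm).trans
      (f.quotKerEquivRange.trans (LinearEquiv.ofEq _ _ hr))
  have e4 : (range φ).submoduleOf (ker ψ) ≃ₗ[k] ↥(range φ ⊓ ker ψ) := by
    refine LinearEquiv.ofBijective ((ker ψ).subtype.restrict
      fun z hz ↦ Submodule.mem_inf.2 ⟨hz, z.2⟩) ⟨?_, ?_⟩
    · exact fun a b h ↦ Subtype.ext (Subtype.ext (by have := congrArg Subtype.val h; exact this))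
    · rintro ⟨a, ha, hb⟩
      exact ⟨⟨⟨a, hb⟩, ha⟩, rfl⟩
  have h11 := Submodule.finrank_quotient_add_finrank ((range φ).submoduleOf (ker ψ))
  rw [e3.finrank_eq, e4.finrank_eq] at h11
  rw [← e1.finrank_eq] at h9
  simp only [coindex]
  omega

/-- In a composition of commuting endomorphisms with an index, each factor has an index. -/
lemma HasIndex.of_comp_of_comm {φ ψ : M →ₗ[k] M} (hc : ψ ∘ₗ φ = φ ∘ₗ ψ)
    (h : (ψ ∘ₗ φ).HasIndex) : φ.HasIndex := by
  obtain ⟨h1, h2⟩ := h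
  refine ⟨Submodule.finiteDimensional_of_le (ker_le_ker_comp φ ψ), ?_⟩
  have hR : range (ψ ∘ₗ φ) ≤ range φ := hc ▸ range_comp_le_range ψ φ
  exact Module.Finite.of_surjective (Submodule.factor hR) (Submodule.factor_surjective hR)

lemma HasIndex.of_finite [FiniteDimensional k M] (φ : M →ₗ[k] M) :
    φ.HasIndex ∧ φ.coindex = 0 := by
  refine ⟨⟨inferInstance, inferInstance⟩, ?_⟩
  have h1 := finrank_range_add_finrank_ker φ
  have h2 := Submodule.finrank_quotient_add_finrank (range φ)
  simp only [coindex]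
  omega

lemma HasIndex.of_bijective (φ : M →ₗ[k] N) (h : Function.Bijective φ) :
    φ.HasIndex ∧ φ.coindex = 0 := by
  have h1 : ker φ = ⊥ := ker_eq_bot.2 h.1
  have h2 : range φ = ⊤ := range_eq_top.2 h.2
  have : Subsingleton (N ⧸ range φ) := Submodule.Quotient.subsingleton_iff.2 h2
  have : Subsingleton (ker φ) := (Submodule.subsingleton_iff_eq_bot).2 h1
  refine ⟨⟨inferInstance, inferInstance⟩, ?_⟩
  simp [coindex, Module.finrank_zero_of_subsingleton]

/-- The index is invariant under conjugation. -/
lemma HasIndex.conj {φ : M →ₗ[k] M} {ψ : N →ₗ[k] N} (e : M ≃ₗ[k] N)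
    (he : ∀ m, e (φ m) = ψ (e m)) (hφ : φ.HasIndex) :
    ψ.HasIndex ∧ ψ.coindex = φ.coindex := by
  have h1 := HasIndex.of_bijective e.toLinearMap e.bijective
  have h2 := HasIndex.of_bijective e.symm.toLinearMap e.symm.bijective
  have h3 := (h2.1.comp hφ)
  have h4 := h3.1.comp h1.1
  have : ψ = e.toLinearMap ∘ₗ (φ ∘ₗ e.symm.toLinearMap) := by
    ext n
    simp [he]
  rw [this]
  exact ⟨h4.1, by rw [h4.2, h3.2, h1.2, h2.2]; ring⟩

lemma HasIndex.prodMap_id {φ : M →ₗ[k] M} (hφ : φ.HasIndex) :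
    (φ.prodMap (id : N →ₗ[k] N)).HasIndex ∧
      (φ.prodMap (id : N →ₗ[k] N)).coindex = φ.coindex := by
  obtain ⟨h1, h2⟩ := hφ
  let Φ := φ.prodMap (id : N →ₗ[k] N)
  have e1 : ker φ ≃ₗ[k] ker Φ := by
    refine LinearEquiv.ofBijective ((inl k M N).restrict fun z hz ↦ ?_) ⟨?_, ?_⟩
    · simpa [Φ] using hz
    · rintro ⟨a, _⟩ ⟨b, _⟩ h
      simpa [LinearMap.restrict_apply] using h
    · rintro ⟨⟨a, b⟩, hab⟩
      simp only [Φ, mem_ker, prodMap_apply, id_apply, Prod.mk_eq_zero] at hab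
      obtain ⟨ha, rfl⟩ := hab
      exact ⟨⟨a, ha⟩, rfl⟩
  have e2 : ((M × N) ⧸ range Φ) ≃ₗ[k] M ⧸ range φ := by
    let f : M × N →ₗ[k] M ⧸ range φ := (range φ).mkQ ∘ₗ fst k M N
    have hk : ker f = range Φ := by
      ext ⟨a, b⟩
      simp [f, Φ]
    refine (Submodule.quotEquivOfEq _ _ hk.symm).trans (f.quotKerEquivOfSurjective ?_)
    exact (Submodule.mkQ_surjective _).comp fst_surjective
  exact ⟨⟨e1.finiteDimensional, e2.symm.finiteDimensional⟩, by
    simp only [coindex]; rw [e1.finrank_eq, e2.finrank_eq]⟩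

/-- Additivity of the index on an invariant subspace and the quotient. -/
lemma HasIndex.add {φ : M →ₗ[k] M} (S : Submodule k M) {α : S →ₗ[k] S}
    {β : (M ⧸ S) →ₗ[k] (M ⧸ S)} (hα : ∀ s, (α s : M) = φ s)
    (hβ : ∀ m, β (S.mkQ m) = S.mkQ (φ m)) (iα : α.HasIndex) (iβ : β.HasIndex) :
    φ.HasIndex ∧ φ.coindex = α.coindex + β.coindex := by
  obtain ⟨s, hs⟩ := S.mkQ.exists_rightInverse_of_surjective (range_eq_top.2 S.mkQ_surjective)
  have hs' : ∀ q, S.mkQ (s q) = q := fun q ↦ LinearMap.congr_fun hs q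
  let sec : (M ⧸ S) → M := s
  have hγ : ∀ q, φ (s q) - s (β q) ∈ S := fun q ↦ by
    rw [← Submodule.Quotient.mk_eq_zero, ← Submodule.mkQ_apply, map_sub, hs', ← hβ, hs', sub_self]
  let γ : (M ⧸ S) →ₗ[k] S := (φ ∘ₗ s - s ∘ₗ β).codRestrict S hγ
  let e : (S × (M ⧸ S)) ≃ₗ[k] M := by
    refine LinearEquiv.ofBijective (S.subtype.coprod s) ⟨?_, ?_⟩
    · rw [← ker_eq_bot, eq_bot_iff]
      rintro ⟨a, q⟩ h
      have h0 : (a : M) + s q = 0 := by simpa using h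
      have hq : q = 0 := by
        have := congrArg S.mkQ h0
        rw [map_add, hs', map_zero] at this
        simpa [(Submodule.Quotient.mk_eq_zero S).2 a.2] using this
      subst hq
      simpa using h0
    · intro m
      have : m - s (S.mkQ m) ∈ S := by
        rw [← Submodule.Quotient.mk_eq_zero, ← Submodule.mkQ_apply, map_sub, hs', sub_self]
      exact ⟨(⟨_, this⟩, S.mkQ m), by simp⟩
  let sh : (S × (M ⧸ S)) →ₗ[k] (S × (M ⧸ S)) :=
    (fst k S (M ⧸ S) + γ ∘ₗ snd k S (M ⧸ S)).prod (snd k S (M ⧸ S))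
  have he (a q) : e (a, q) = a + s q := rfl
  have hγ' (q) : (γ q : M) = φ (s q) - s (β q) := rfl
  have hsh' (a q) : sh (a, q) = (a + γ q, q) := rfl
  have hsh : Function.Bijective sh := by
    constructor
    · rintro ⟨a, q⟩ ⟨b, r⟩ h
      simp only [hsh', Prod.mk.injEq] at h
      obtain ⟨h1, rfl⟩ := h
      simpa using h1
    · rintro ⟨a, q⟩
      exact ⟨(a - γ q, q), by simp [hsh']⟩
  have i1 := HasIndex.prodMap_id (N := M ⧸ S) iα
  have i2 := HasIndex.of_bijective sh hsh
  have i3 := HasIndex.prodMap_id (N := S) iβ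
  have i4 := HasIndex.conj (ψ := (id : S →ₗ[k] S).prodMap β)
    (LinearEquiv.prodComm k (M ⧸ S) S) (fun m ↦ by simp) i3.1
  have i5 := i1.1.comp i2.1
  have i6 := i5.1.comp i4.1
  have i7 := HasIndex.conj (ψ := φ) e (fun m ↦ ?_) i6.1
  · exact ⟨i7.1, by rw [i7.2, i6.2, i5.2, i4.2, i3.2, i2.2, i1.2]; ring⟩
  · obtain ⟨a, q⟩ := m
    simp only [comp_apply, prodMap_apply, id_apply, hsh', he, Submodule.coe_add, hα, hγ', map_add]
    abel

end LinearMap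

section Index

open LinearMap

variable (k : Type*) {A : Type*} [Field k] [CommRing A] [Algebra k A]
  (M : Type*) [AddCommGroup M] [Module k M] [Module A M] [IsScalarTower k A M]
  {N : Type*} [AddCommGroup N] [Module k N] [Module A N] [IsScalarTower k A N]

/-- Multiplication by `a` on `M` has finite-dimensional kernel and cokernel. -/
def HasIdx (a : A) : Prop := (Algebra.lsmul k k M a).HasIndex

/-- The dimension of `M / a M` minus the dimension of the `a`-torsion of `M`. -/
noncomputable def idx (a : A) : ℤ := (Algebra.lsmul k k M a).coindex

variable {k M}

lemma HasIdx.mul {a b : A} (ha : HasIdx k M a) (hb : HasIdx k M b) : HasIdx k M (a * b) := by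
  have := (HasIndex.comp hb ha).1
  rwa [HasIdx, map_mul]

lemma idx_mul {a b : A} (ha : HasIdx k M a) (hb : HasIdx k M b) :
    idx k M (a * b) = idx k M a + idx k M b := by
  have := (HasIndex.comp hb ha).2
  rwa [idx, map_mul]

lemma HasIdx.of_mul_left {a b : A} (h : HasIdx k M (a * b)) : HasIdx k M a := by
  refine HasIndex.of_comp_of_comm (ψ := Algebra.lsmul k k M b) ?_ ?_
  · ext m
    simp [smul_comm a b m]
  · rw [HasIdx, mul_comm, map_mul] at h
    exact h

lemma HasIdx.of_dvd {a b : A} (h : HasIdx k M b) (hab : a ∣ b) : HasIdx k M a := by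
  obtain ⟨c, rfl⟩ := hab
  exact h.of_mul_left

lemma hasIdx_of_bijective (a : A) (h : Function.Bijective fun m : M ↦ a • m) :
    HasIdx k M a ∧ idx k M a = 0 :=
  HasIndex.of_bijective _ h

lemma hasIdx_one : HasIdx k M (1 : A) ∧ idx k M (1 : A) = 0 :=
  hasIdx_of_bijective _ (by simpa using! Function.bijective_id)

lemma HasIdx.pow {a : A} (ha : HasIdx k M a) (n : ℕ) : HasIdx k M (a ^ n) := by
  induction n with
  | zero => simpa using hasIdx_one.1
  | succ n ih => exact pow_succ a n ▸ ih.mul ha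

lemma idx_pow {a : A} (ha : HasIdx k M a) (n : ℕ) : idx k M (a ^ n) = n * idx k M a := by
  induction n with
  | zero => simpa using hasIdx_one.2
  | succ n ih =>
    rw [pow_succ, idx_mul (ha.pow n) ha, ih]
    push_cast
    ring

lemma HasIdx.of_pow {a : A} {n : ℕ} (hn : n ≠ 0) (h : HasIdx k M (a ^ n)) : HasIdx k M a :=
  h.of_dvd (dvd_pow_self a hn)

lemma hasIdx_of_finite [FiniteDimensional k M] (a : A) : HasIdx k M a ∧ idx k M a = 0 :=
  HasIndex.of_finite _

lemma HasIdx.congr (e : M ≃ₗ[A] N) {a : A} (h : HasIdx k M a) :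
    HasIdx k N a ∧ idx k N a = idx k M a :=
  HasIndex.conj (e.restrictScalars k) (fun m ↦ by simp) h

/-- If two ring elements act in the same way, they have the same index. -/
lemma HasIdx.of_smul_eq {a b : A} (hab : ∀ m : M, a • m = b • m) (h : HasIdx k M a) :
    HasIdx k M b ∧ idx k M b = idx k M a :=
  HasIndex.conj (LinearEquiv.refl k M) (fun m ↦ hab m) h

/-- Additivity of the index in short exact sequences. -/
lemma HasIdx.add (S : Submodule A M) {a : A} (h1 : HasIdx k S a) (h2 : HasIdx k (M ⧸ S) a) :
    HasIdx k M a ∧ idx k M a = idx k S a + idx k (M ⧸ S) a := by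
  let S' := S.restrictScalars k
  let e : (M ⧸ S') ≃ₗ[k] M ⧸ S := Submodule.Quotient.restrictScalarsEquiv k S
  let β : (M ⧸ S') →ₗ[k] (M ⧸ S') := e.symm.toLinearMap ∘ₗ Algebra.lsmul k k (M ⧸ S) a ∘ₗ e
  have hβ := HasIndex.conj (ψ := β) e.symm (fun m ↦ by simp [β]) h2
  have := HasIndex.add (φ := Algebra.lsmul k k M a) S' (α := Algebra.lsmul k k S a) (β := β)
    (fun s ↦ rfl) (fun m ↦ rfl) h1 hβ.1
  exact ⟨this.1, by rw [idx, this.2, hβ.2]; rfl⟩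

/-- The two projections of a fibre product have isomorphic kernels: this symmetric statement
compares the torsion submodules `(A/g)[f]` and `(A/f)[g]`. -/
lemma quotient_torsion_equiv [IsDomain A] {f g : A} (hf : f ≠ 0) (hg : g ≠ 0) :
    Nonempty (ker (Algebra.lsmul k k (A ⧸ Ideal.span {g}) f) ≃ₗ[k]
      ker (Algebra.lsmul k k (A ⧸ Ideal.span {f}) g)) := by
  let Z : Submodule k (A × A) :=
    ker ((Algebra.lsmul k k A f).coprod (-(Algebra.lsmul k k A g) : A →ₗ[k] A))
  have hZ (z : A × A) : z ∈ Z ↔ f * z.1 = g * z.2 := by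
    simp [Z, add_neg_eq_zero]
  let p : Z →ₗ[k] A ⧸ Ideal.span {g} :=
    (Ideal.Quotient.mkₐ k (Ideal.span {g})).toLinearMap ∘ₗ fst k A A ∘ₗ Z.subtype
  let q : Z →ₗ[k] A ⧸ Ideal.span {f} :=
    (Ideal.Quotient.mkₐ k (Ideal.span {f})).toLinearMap ∘ₗ snd k A A ∘ₗ Z.subtype
  have hp (z : Z) : p z = Ideal.Quotient.mk _ z.1.1 := rfl
  have hq (z : Z) : q z = Ideal.Quotient.mk _ z.1.2 := rfl
  have rp : range p = ker (Algebra.lsmul k k (A ⧸ Ideal.span {g}) f) := by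
    ext t
    obtain ⟨t, rfl⟩ := Ideal.Quotient.mk_surjective t
    have : Ideal.Quotient.mk (Ideal.span {g}) t ∈ ker (Algebra.lsmul k k (A ⧸ Ideal.span {g}) f)
        ↔ g ∣ f * t := by
      rw [← Ideal.mem_span_singleton, ← Ideal.Quotient.eq_zero_iff_mem]
      rfl
    rw [this]
    constructor
    · rintro ⟨⟨⟨a, b⟩, hab⟩, h⟩
      rw [hp, Ideal.Quotient.eq, Ideal.mem_span_singleton] at h
      have hab := (hZ _).1 hab
      obtain ⟨c, hc⟩ := h
      exact ⟨b - f * c, by simp only at hab hc; linear_combination hab - f * hc⟩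
    · rintro ⟨b, hb⟩
      exact ⟨⟨(t, b), (hZ _).2 hb⟩, rfl⟩
  have rq : range q = ker (Algebra.lsmul k k (A ⧸ Ideal.span {f}) g) := by
    ext t
    obtain ⟨t, rfl⟩ := Ideal.Quotient.mk_surjective t
    have : Ideal.Quotient.mk (Ideal.span {f}) t ∈ ker (Algebra.lsmul k k (A ⧸ Ideal.span {f}) g)
        ↔ f ∣ g * t := by
      rw [← Ideal.mem_span_singleton, ← Ideal.Quotient.eq_zero_iff_mem]
      rfl
    rw [this]
    constructor
    · rintro ⟨⟨⟨a, b⟩, hab⟩, h⟩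
      rw [hq, Ideal.Quotient.eq, Ideal.mem_span_singleton] at h
      have hab := (hZ _).1 hab
      obtain ⟨c, hc⟩ := h
      exact ⟨a - g * c, by simp only at hab hc; linear_combination -hab - g * hc⟩
    · rintro ⟨b, hb⟩
      exact ⟨⟨(b, t), (hZ _).2 hb.symm⟩, rfl⟩
  have hk : ker p = ker q := by
    ext ⟨⟨a, b⟩, hab⟩
    have hab := (hZ _).1 hab
    rw [mem_ker, mem_ker, hp, hq, Ideal.Quotient.eq_zero_iff_dvd, Ideal.Quotient.eq_zero_iff_dvd]
    simp only at hab ⊢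
    constructor
    · rintro ⟨c, rfl⟩
      exact ⟨c, mul_left_cancel₀ hg (by linear_combination -hab)⟩
    · rintro ⟨c, rfl⟩
      exact ⟨c, mul_left_cancel₀ hf (by linear_combination hab)⟩
  exact ⟨((LinearEquiv.ofEq _ _ rp).symm.trans p.quotKerEquivRange.symm).trans
    ((Submodule.quotEquivOfEq _ _ hk).trans (q.quotKerEquivRange.trans (LinearEquiv.ofEq _ _ rq)))⟩

/-- The cokernels of `f` on `A/g` and of `g` on `A/f` agree. -/
lemma quotient_coker_equiv (f g : A) :
    Nonempty (((A ⧸ Ideal.span {g}) ⧸ range (Algebra.lsmul k k (A ⧸ Ideal.span {g}) f)) ≃ₗ[k]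
      ((A ⧸ Ideal.span {f}) ⧸ range (Algebra.lsmul k k (A ⧸ Ideal.span {f}) g))) := by
  have key (f g : A) : Nonempty (((A ⧸ Ideal.span {g}) ⧸
      range (Algebra.lsmul k k (A ⧸ Ideal.span {g}) f)) ≃ₗ[k] A ⧸ Ideal.span {f, g}) := by
    let p : (A ⧸ Ideal.span {g}) →ₗ[k] A ⧸ Ideal.span {f, g} :=
      (Ideal.Quotient.factorₐ k (Ideal.span_mono (by simp) :
        Ideal.span {g} ≤ Ideal.span {f, g})).toLinearMap
    have hp (a : A) : p (Ideal.Quotient.mk _ a) = Ideal.Quotient.mk _ a := rfl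
    have hs : Function.Surjective p := fun t ↦ by
      obtain ⟨t, rfl⟩ := Ideal.Quotient.mk_surjective t
      exact ⟨_, hp t⟩
    have hk : ker p = range (Algebra.lsmul k k (A ⧸ Ideal.span {g}) f) := by
      ext t
      obtain ⟨t, rfl⟩ := Ideal.Quotient.mk_surjective t
      rw [mem_ker, hp, Ideal.Quotient.eq_zero_iff_mem, Ideal.mem_span_pair]
      constructor
      · rintro ⟨a, b, rfl⟩
        refine ⟨Ideal.Quotient.mk _ a, ?_⟩
        change Ideal.Quotient.mk _ (f * a) = _
        rw [Ideal.Quotient.eq, Ideal.mem_span_singleton]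
        exact ⟨-b, by ring⟩
      · rintro ⟨a, ha⟩
        obtain ⟨a, rfl⟩ := Ideal.Quotient.mk_surjective a
        change Ideal.Quotient.mk _ (f * a) = _ at ha
        rw [Ideal.Quotient.eq, Ideal.mem_span_singleton] at ha
        obtain ⟨b, hb⟩ := ha
        exact ⟨a, -b, by linear_combination hb⟩
    exact ⟨(Submodule.quotEquivOfEq _ _ hk.symm).trans (p.quotKerEquivOfSurjective hs)⟩
  obtain ⟨e1⟩ := key f g
  obtain ⟨e2⟩ := key g f
  rw [Set.pair_comm] at e2
  exact ⟨e1.trans e2.symm⟩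

/-- The index of `f` on `A/g` equals the index of `g` on `A/f`. -/
lemma HasIdx.symm [IsDomain A] {f g : A} (hf : f ≠ 0) (hg : g ≠ 0)
    (h : HasIdx k (A ⧸ Ideal.span {g}) f) :
    HasIdx k (A ⧸ Ideal.span {f}) g ∧
      idx k (A ⧸ Ideal.span {f}) g = idx k (A ⧸ Ideal.span {g}) f := by
  obtain ⟨e1⟩ := quotient_torsion_equiv (k := k) hf hg
  obtain ⟨e2⟩ := quotient_coker_equiv (k := k) f g
  obtain ⟨h1, h2⟩ := h
  refine ⟨⟨e1.finiteDimensional, e2.finiteDimensional⟩, ?_⟩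
  rw [idx, idx, coindex, coindex, e1.finrank_eq, e2.finrank_eq]

/-- A finite module killed by an ideal of finite codimension is finite-dimensional. -/
lemma finite_of_smul_eq_zero [Module.Finite A M] (L : Ideal A) [Module.Finite k (A ⧸ L)]
    (hL : ∀ a ∈ L, ∀ m : M, a • m = 0) : Module.Finite k M := by
  obtain ⟨s, hs⟩ := (inferInstance : Module.Finite A M)
  obtain ⟨t, ht⟩ := (inferInstance : Module.Finite k (A ⧸ L))
  refine ⟨?_⟩
  have h1 (m : M) : ∃ φ : (A ⧸ L) →ₗ[k] M, ∀ a : A, φ (Ideal.Quotient.mk L a) = a • m := by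
    refine ⟨((L.restrictScalars k).liftQ ((LinearMap.toSpanSingleton A M m).restrictScalars k) ?_) ∘ₗ
      (Submodule.Quotient.restrictScalarsEquiv k L).symm.toLinearMap, fun a ↦ rfl⟩
    intro a ha
    exact hL a ha m
  choose φ hφ using h1
  have h2 : (⊤ : Submodule k M) = ⨆ m ∈ s, range (φ m) := by
    refine (eq_top_iff.2 fun m _ ↦ ?_).symm
    have hm : m ∈ Submodule.span A (s : Set M) := hs ▸ Submodule.mem_top
    induction hm using Submodule.span_induction with
    | mem x hx =>
      exact Submodule.mem_iSup_of_mem x (Submodule.mem_iSup_of_mem hx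
        ⟨Ideal.Quotient.mk L 1, by rw [hφ, one_smul]⟩)
    | zero => exact zero_mem _
    | add x y _ _ hx hy => exact add_mem (hx trivial) (hy trivial)
    | smul a x _ hx =>
      have h3 := Submodule.mem_map_of_mem (f := Algebra.lsmul k k M a) (hx trivial)
      refine Submodule.map_le_iff_le_comap.2 ?_ h3
      refine iSup₂_le fun m hm ↦ ?_
      rintro _ ⟨b, rfl⟩
      obtain ⟨b, rfl⟩ := Ideal.Quotient.mk_surjective b
      exact Submodule.mem_iSup_of_mem m (Submodule.mem_iSup_of_mem hm
        ⟨Ideal.Quotient.mk L (a * b), by rw [hφ, hφ, mul_smul]; rfl⟩)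
  rw [h2]
  exact Submodule.fg_biSup s _ fun m _ ↦ by
    rw [range_eq_map]
    exact Submodule.FG.map _ ⟨t, ht⟩

/-- An element of `A` has an index on finite modules as soon as it generates, together with the
annihilator, an ideal of finite codimension. -/
lemma hasIdx_of_finite_quotient [IsNoetherianRing A] [Module.Finite A M] (I : Ideal A)
    (hI : ∀ a ∈ I, ∀ m : M, a • m = 0) (f : A) (h : Module.Finite k (A ⧸ (I ⊔ Ideal.span {f}))) :
    HasIdx k M f := by
  have hl : ∀ (N : Type _) [AddCommGroup N] [Module A N], (∀ a ∈ I, ∀ m : N, a • m = 0) →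
      (∀ m : N, f • m = 0) → ∀ a ∈ I ⊔ Ideal.span {f}, ∀ m : N, a • m = 0 := by
    intro N _ _ h1 h2 a ha m
    obtain ⟨b, hb, c, hc, rfl⟩ := Submodule.mem_sup.1 ha
    obtain ⟨c, rfl⟩ := Ideal.mem_span_singleton.1 hc
    rw [add_smul, h1 b hb, mul_comm, mul_smul, h2, smul_zero, add_zero]
  constructor
  · let S : Submodule A M := ker (Algebra.lsmul A A M f)
    have hS : ∀ a ∈ I ⊔ Ideal.span {f}, ∀ m : S, a • m = 0 :=
      hl S (fun a ha m ↦ Subtype.ext (hI a ha m)) (fun m ↦ Subtype.ext m.2)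
    have := finite_of_smul_eq_zero (k := k) (M := S) _ hS
    exact this
  · let S : Submodule A M := range (Algebra.lsmul A A M f)
    have hS : ∀ a ∈ I ⊔ Ideal.span {f}, ∀ m : M ⧸ S, a • m = 0 := by
      refine hl _ (fun a ha m ↦ ?_) (fun m ↦ ?_)
      · obtain ⟨m, rfl⟩ := S.mkQ_surjective m
        rw [← map_smul, hI a ha, map_zero]
      · obtain ⟨m, rfl⟩ := S.mkQ_surjective m
        rw [← map_smul, Submodule.mkQ_apply, Submodule.Quotient.mk_eq_zero]
        exact ⟨m, rfl⟩
    have := finite_of_smul_eq_zero (k := k) (M := M ⧸ S) _ hS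
    exact (Submodule.Quotient.restrictScalarsEquiv k S).symm.finiteDimensional

/-- An ideal of a Noetherian algebra has finite codimension if all primes containing it do. -/
lemma finite_quotient_of_forall_prime [IsNoetherianRing A] (I : Ideal A)
    (h : ∀ P : Ideal A, P.IsPrime → I ≤ P → Module.Finite k (A ⧸ P)) :
    Module.Finite k (A ⧸ I) := by
  by_contra hI
  obtain ⟨J, ⟨hJ1, hJ2⟩, hJ⟩ := set_has_maximal_iff_noetherian.2 ‹IsNoetherianRing A›
    {J : Ideal A | I ≤ J ∧ ¬ Module.Finite k (A ⧸ J)} ⟨I, le_rfl, hI⟩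
  refine hJ2 (h J ?_ hJ1)
  have hmax (L : Ideal A) (hL : J < L) : Module.Finite k (A ⧸ L) := by
    by_contra hL'
    exact hJ L ⟨hJ1.trans hL.le, hL'⟩ hL
  refine ⟨?_, ?_⟩
  · rintro rfl
    exact hJ2 (inferInstance)
  · intro a b hab
    by_contra! hc
    refine hJ2 ?_
    let L := J ⊔ Ideal.span {a}
    have hL : J < L := lt_of_le_of_ne le_sup_left fun h ↦
      hc.1 (h ▸ Ideal.mem_sup_right (Ideal.mem_span_singleton_self a))
    have hb : J < J ⊔ Ideal.span {b} := lt_of_le_of_ne le_sup_left fun h ↦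
      hc.2 (h ▸ Ideal.mem_sup_right (Ideal.mem_span_singleton_self b))
    have f1 := hmax _ hb
    have f2 := hmax _ hL
    let S : Submodule A (A ⧸ J) := Submodule.map J.mkQ L
    have hS : ∀ c ∈ J ⊔ Ideal.span {b}, ∀ m : S, c • m = 0 := by
      rintro c hc' ⟨_, ⟨m, hm, rfl⟩⟩
      refine Subtype.ext ?_
      change c • J.mkQ m = 0
      rw [← map_smul, Submodule.mkQ_apply, Submodule.Quotient.mk_eq_zero]
      obtain ⟨c1, h1, c2, h2, rfl⟩ := Submodule.mem_sup.1 hc'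
      obtain ⟨m1, h3, m2, h4, rfl⟩ := Submodule.mem_sup.1 hm
      obtain ⟨c2, rfl⟩ := Ideal.mem_span_singleton.1 h2
      obtain ⟨m2, rfl⟩ := Ideal.mem_span_singleton.1 h4
      have : (c1 + b * c2) • (m1 + a * m2) =
        (m1 + a * m2) * c1 + (b * c2) * m1 + (c2 * m2) * (a * b) := by
        simp only [smul_eq_mul]; ring
      rw [this]
      exact add_mem (add_mem (Ideal.mul_mem_left J _ h1) (Ideal.mul_mem_left J _ h3)) (Ideal.mul_mem_left J _ hab)
    have f3 : Module.Finite k S := finite_of_smul_eq_zero _ hS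
    have f4 : Module.Finite k ((A ⧸ J) ⧸ S) := by
      have e := (Submodule.quotientQuotientEquivQuotient J L hL.le).restrictScalars k
      exact e.symm.finiteDimensional
    let S' := S.restrictScalars k
    have : Module.Finite k S' := f3
    have : Module.Finite k ((A ⧸ J) ⧸ S') :=
      (Submodule.Quotient.restrictScalarsEquiv k S).symm.finiteDimensional
    exact Module.Finite.of_submodule_quotient S'

end Index

section Core

open IsDedekindDomain

/-- `f₁ / f₂` is an `n`-th power modulo all powers of `w`. -/
def IsPowerAt {R : Type*} [CommRing R] (n : ℕ) (f₁ f₂ : R) (w : HeightOneSpectrum R) : Prop :=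
  ∀ j : ℕ, ∃ z : R, f₁ - z ^ n * f₂ ∈ w.asIdeal ^ j

lemma exists_sub_pow_mul_mem {R : Type*} [CommRing R] [IsDedekindDomain R] {n : ℕ} {f₁ f₂ : R}
    {I : Ideal R} (hI : I ≠ ⊥)
    (h : ∀ w : HeightOneSpectrum R, I ≤ w.asIdeal → IsPowerAt n f₁ f₂ w) :
    ∃ z : R, f₁ - z ^ n * f₂ ∈ I := by
  classical
  let s := (UniqueFactorizationMonoid.normalizedFactors I).toFinset
  let e (P : Ideal R) : ℕ := (UniqueFactorizationMonoid.normalizedFactors I).count P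
  have hs : ∀ P ∈ s, Prime P := fun P hP ↦
    UniqueFactorizationMonoid.prime_of_normalized_factor P (Multiset.mem_toFinset.1 hP)
  have hI' : s.inf (fun P ↦ P ^ e P) = I := by
    rw [inf_pow_eq_prod_of_prime s (fun P ↦ P) e hs (fun _ _ _ _ h ↦ h),
      ← Finset.prod_multiset_count, Ideal.prod_normalizedFactors_eq_self hI]
  have h1 (P : s) : ∃ z : R, f₁ - z ^ n * f₂ ∈ (P : Ideal R) ^ e P := by
    have hP := hs P P.2
    let w : HeightOneSpectrum R := ⟨P, Ideal.isPrime_of_prime hP, hP.ne_zero⟩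
    refine h w ?_ (e P)
    exact Ideal.dvd_iff_le.1
      (UniqueFactorizationMonoid.dvd_of_mem_normalizedFactors (Multiset.mem_toFinset.1 P.2))
  choose z hz using h1
  obtain ⟨y, hy⟩ := exists_forall_sub_mem_ideal (fun P : Ideal R ↦ P) e hs
    (fun _ _ _ _ h ↦ h) z
  refine ⟨y, ?_⟩
  rw [← hI', Submodule.mem_finsetInf]
  intro P hP
  have h2 : y ^ n - z ⟨P, hP⟩ ^ n ∈ P ^ e P :=
    Ideal.mem_of_dvd _ (sub_dvd_pow_sub_pow _ _ n) (hy P hP)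
  have h3 := hz ⟨P, hP⟩
  have : f₁ - y ^ n * f₂ = (f₁ - z ⟨P, hP⟩ ^ n * f₂) - f₂ * (y ^ n - z ⟨P, hP⟩ ^ n) := by ring
  rw [this]
  exact sub_mem h3 (Ideal.mul_mem_left _ _ h2)

/-- Clearing denominators in a congruence between elements of a localization. -/
lemma exists_pow_mul_sub_mem {A R : Type*} [CommRing A] [IsNoetherianRing A] [CommRing R]
    [Algebra A R] (x : A) [IsLocalization.Away x R] {n : ℕ} (hn : n ≠ 0) (f₁ f₂ g : A) (J : Ideal A)
    (z : R) (h : ∀ b ∈ J, (algebraMap A R f₁ - z ^ n * algebraMap A R f₂) * algebraMap A R b ∈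
      Ideal.span {algebraMap A R g}) :
    ∃ (m : ℕ) (y : A), ∀ b ∈ J, (f₁ * (x ^ m) ^ n - y ^ n * f₂) * b ∈ Ideal.span {g} := by
  classical
  obtain ⟨r, z', hz⟩ := IsLocalization.Away.surj x z
  have h1 (b : A) (hb : b ∈ J) :
      ∃ t : ℕ, x ^ t * ((f₁ * (x ^ r) ^ n - z' ^ n * f₂) * b) ∈ Ideal.span {g} := by
    obtain ⟨c, hc⟩ := Ideal.mem_span_singleton.1 (h b hb)
    obtain ⟨t, c', hc'⟩ := IsLocalization.Away.surj x c
    have h2 : algebraMap A R (x ^ t * ((f₁ * (x ^ r) ^ n - z' ^ n * f₂) * b)) =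
        algebraMap A R (g * c' * (x ^ r) ^ n) := by
      simp only [map_mul, map_sub, map_pow, ← hz, ← hc']
      linear_combination (algebraMap A R x ^ r) ^ n * algebraMap A R x ^ t * hc
    obtain ⟨u, hu⟩ := IsLocalization.Away.exists_of_eq x h2
    refine ⟨u + t, Ideal.mem_span_singleton.2 ⟨x ^ u * c' * (x ^ r) ^ n, ?_⟩⟩
    linear_combination hu
  have h3 : ∃ t : ℕ, ∀ b ∈ J, x ^ t * ((f₁ * (x ^ r) ^ n - z' ^ n * f₂) * b) ∈ Ideal.span {g} := by
    obtain ⟨s, hs⟩ := (isNoetherianRing_iff_ideal_fg A).1 inferInstance J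
    have hsJ (b : s) : (b : A) ∈ J := hs ▸ Ideal.subset_span b.2
    choose t ht using fun b : s ↦ h1 b (hsJ b)
    refine ⟨∑ b, t b, fun b hb ↦ ?_⟩
    have : J ≤ Submodule.comap
        (LinearMap.mulLeft A (x ^ (∑ b, t b) * (f₁ * (x ^ r) ^ n - z' ^ n * f₂)))
        (Ideal.span {g}) := by
      rw [← hs, Ideal.span_le]
      intro b hb
      have h4 := Ideal.mul_mem_left _ (x ^ (∑ c ∈ Finset.univ.erase ⟨b, hb⟩, t c)) (ht ⟨b, hb⟩)
      rw [← mul_assoc, ← pow_add, Finset.sum_erase_add _ _ (Finset.mem_univ _), ← mul_assoc] at h4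
      exact h4
    have := this hb
    rwa [Submodule.mem_comap, LinearMap.mulLeft_apply, mul_assoc] at this
  obtain ⟨t, ht⟩ := h3
  refine ⟨r + t, z' * x ^ t, fun b hb ↦ ?_⟩
  have h5 := Ideal.mul_mem_left _ (x ^ (t * (n - 1))) (ht b hb)
  have h6 : (x ^ t) ^ n = x ^ (t * (n - 1)) * x ^ t := by
    rw [← pow_mul, ← pow_add]
    congr 1
    obtain ⟨n, rfl⟩ := Nat.exists_eq_succ_of_ne_zero hn
    simp [mul_add]
  convert h5 using 1
  rw [pow_add, mul_pow, mul_pow, h6]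
  ring

variable {k A R : Type*} [Field k] [CommRing A] [Algebra k A] [CommRing R] [IsDedekindDomain R]
  [Algebra A R]

lemma dvd_idx_sub {M : Type*} [AddCommGroup M] [Module k M] [Module A M] [IsScalarTower k A M]
    {n : ℕ} (hn : n ≠ 0) {f₁ f₂ X z : A} (h : ∀ m : M, (f₁ * X ^ n) • m = (z ^ n * f₂) • m)
    (h1 : HasIdx k M f₁) (h2 : HasIdx k M f₂) (hX : HasIdx k M X) :
    (n : ℤ) ∣ idx k M f₁ - idx k M f₂ := by
  obtain ⟨h3, h4⟩ := (h1.mul (hX.pow n)).of_smul_eq h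
  have hz : HasIdx k M z := h3.of_mul_left.of_pow hn
  rw [idx_mul (hz.pow n) h2, idx_mul h1 (hX.pow n), idx_pow hz, idx_pow hX] at h4
  exact ⟨idx k M z - idx k M X, by linear_combination -h4⟩

variable [IsDomain A] [IsNoetherianRing A] (x : A) [IsLocalization.Away x R]

/-- All inclusions between nonzero primes of `A` end in a closed point on `x = 0`. -/
def IsSurfaceLike (k : Type*) {A : Type*} [Field k] [CommRing A] [Algebra k A] (x : A) : Prop :=
  ∀ P Q : Ideal A, P.IsPrime → Q.IsPrime → P ≠ ⊥ → P < Q → x ∈ Q ∧ Module.Finite k (A ⧸ Q)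

/-- Every common zero of `a` and `b` is a closed point on `x = 0`. -/
def MeetProperly (k : Type*) {A : Type*} [Field k] [CommRing A] [Algebra k A] (x a b : A) : Prop :=
  ∀ P : Ideal A, P.IsPrime → a ∈ P → b ∈ P → x ∈ P ∧ Module.Finite k (A ⧸ P)

variable {x}

omit [IsDomain A] in
lemma exists_meetProperly (hA : IsSurfaceLike k x) {𝔭 : Ideal A} [𝔭.IsPrime] (h0 : 𝔭 ≠ ⊥) {d : A}
    (hd : d ∉ 𝔭) : ∃ e ∈ 𝔭, MeetProperly k x d e := by
  have hd0 : d ≠ 0 := fun h ↦ hd (h ▸ zero_mem _)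
  let T : Set (Ideal A) := {Q | Q ∈ (Ideal.span {d}).minimalPrimes ∧
    ¬ (x ∈ Q ∧ Module.Finite k (A ⧸ Q))}
  have hT : T.Finite := ((Ideal.span {d}).finite_minimalPrimes_of_isNoetherianRing A).subset
    fun Q hQ ↦ hQ.1
  have hdQ (Q : Ideal A) (hQ : Q ∈ (Ideal.span {d}).minimalPrimes) : d ∈ Q :=
    hQ.1.2 (Ideal.mem_span_singleton_self d)
  have h1 : ¬ ((𝔭 : Set A) ⊆ ⋃ Q ∈ (hT.toFinset : Set (Ideal A)), ((id Q : Ideal A) : Set A)) := by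
    intro h
    obtain ⟨Q, hQ, hle⟩ := (Ideal.subset_union_prime (f := id) ⊥ ⊥
      (fun Q hQ _ _ ↦ ((hT.mem_toFinset.1 hQ).1.1.1))).1 h
    obtain ⟨h2, h3⟩ := hT.mem_toFinset.1 hQ
    refine h3 (hA 𝔭 Q inferInstance h2.1.1 h0 (lt_of_le_of_ne hle ?_))
    rintro rfl
    exact hd (hdQ _ h2)
  obtain ⟨e, he, he'⟩ := Set.not_subset.1 h1
  refine ⟨e, he, fun P hP hdP heP ↦ ?_⟩
  obtain ⟨Q, hQ, hQP⟩ := Ideal.exists_minimalPrimes_le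
    ((Ideal.span_singleton_le_iff_mem P).2 hdP)
  have hQ0 : Q ≠ ⊥ := fun h ↦ hd0 (by simpa [h] using hdQ Q hQ)
  by_cases hQT : Q ∈ T
  · refine hA Q P hQ.1.1 hP hQ0 (lt_of_le_of_ne hQP ?_)
    rintro rfl
    exact he' (Set.mem_biUnion (hT.mem_toFinset.2 hQT) heP)
  · rcases hQP.eq_or_lt with rfl | hlt
    · by_contra h
      exact hQT ⟨hQ, h⟩
    · exact hA Q P hQ.1.1 hP hQ0 hlt

omit [IsDomain A] in
lemma hasIdx_of_primes {M : Type*} [AddCommGroup M] [Module k M] [Module A M]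
    [IsScalarTower k A M] [Module.Finite A M] (I : Ideal A) (hI : ∀ a ∈ I, ∀ m : M, a • m = 0)
    (f : A) (h : ∀ P : Ideal A, P.IsPrime → I ≤ P → f ∈ P → Module.Finite k (A ⧸ P)) :
    HasIdx k M f := by
  refine hasIdx_of_finite_quotient I hI f (finite_quotient_of_forall_prime _ fun P hP hle ↦ ?_)
  rw [sup_le_iff, Ideal.span_singleton_le_iff_mem] at hle
  exact h P hP hle.1 hle.2

omit [IsDomain A] [IsNoetherianRing A] in
lemma span_smul_quotient (g : A) : ∀ a ∈ Ideal.span {g}, ∀ m : A ⧸ Ideal.span {g}, a • m = 0 := by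
  intro a ha m
  obtain ⟨m, rfl⟩ := Ideal.Quotient.mk_surjective m
  change Ideal.Quotient.mk _ (a * m) = 0
  exact Ideal.Quotient.eq_zero_iff_mem.2 (Ideal.mul_mem_right _ _ ha)

omit [IsDomain A] in
lemma MeetProperly.hasIdx {d e g : A} (h : MeetProperly k x d e)
    (hg : ∀ P : Ideal A, P.IsPrime → d ∈ P → g ∈ P → e ∈ P) : HasIdx k (A ⧸ Ideal.span {g}) d := by
  refine hasIdx_of_primes _ (span_smul_quotient g) d fun P hP hgP hdP ↦ ?_
  exact (h P hP hdP (hg P hP hdP ((Ideal.span_singleton_le_iff_mem P).1 hgP))).2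

omit [IsNoetherianRing A] in
/-- If `g ≡ e ^ n` modulo `c`, then `c` has index divisible by `n` on `A/g`. -/
lemma dvd_idx_quotient {n : ℕ} {c g e : A} (hc : c ≠ 0) (hg : g ≠ 0)
    (hn : n ≠ 0) (hge : c ∣ g - e ^ n) (h : HasIdx k (A ⧸ Ideal.span {g}) c) :
    (n : ℤ) ∣ idx k (A ⧸ Ideal.span {g}) c := by
  obtain ⟨h1, h2⟩ := h.symm hc hg
  have h3 : ∀ m : A ⧸ Ideal.span {c}, g • m = e ^ n • m := fun m ↦ by
    rw [← sub_eq_zero, ← sub_smul]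
    exact span_smul_quotient c _ (Ideal.mem_span_singleton.2 hge) m
  obtain ⟨h4, h5⟩ := h1.of_smul_eq h3
  rw [idx_pow (h4.of_pow hn)] at h5
  exact ⟨_, by rw [← h2, ← h5]⟩

/-- The index along `𝔭` of any function prime to `𝔭`, times the order of vanishing `a` at `𝔭` of
`π ^ a * d₂ / d₁`, is divisible by `n`, if that function is an `n`-th power at almost all
places. -/
theorem dvd_mul_idx_of_isPowerAt (hx : x ≠ 0) (hA : IsSurfaceLike k x) {n : ℕ} (hn : n ≠ 0)
    (v : HeightOneSpectrum R) (𝔭 : Ideal A) [𝔭.IsPrime]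
    (h𝔭 : ∀ a, a ∈ 𝔭 ↔ algebraMap A R a ∈ v.asIdeal) (h0 : 𝔭 ≠ ⊥)
    {π c d₁ d₂ s : A} {a : ℕ} (hπ : π ∈ 𝔭) (hc : c ∉ 𝔭) (hcπ : ∀ b ∈ 𝔭, π ∣ c * b)
    (hd₁ : d₁ ∉ 𝔭) (hd₂ : d₂ ∉ 𝔭) (hs : s ∉ 𝔭)
    (h : ∀ w : HeightOneSpectrum R, w ≠ v → algebraMap A R s ∉ w.asIdeal →
      IsPowerAt n (algebraMap A R (π ^ a * d₂)) (algebraMap A R d₁) w)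
    (q : A) (hq : q ∉ 𝔭) : (n : ℤ) ∣ a * idx k (A ⧸ 𝔭) q := by
  have hx𝔭 : x ∉ 𝔭 := fun hx' ↦ v.isPrime.ne_top
    (Ideal.eq_top_of_isUnit_mem _ ((h𝔭 x).1 hx') (IsLocalization.Away.algebraMap_isUnit x))
  have hinj : Function.Injective (algebraMap A R) :=
    IsLocalization.injective R (powers_le_nonZeroDivisors_of_noZeroDivisors hx)
  have hπ0 : π ≠ 0 := by
    rintro rfl
    obtain ⟨b, hb, hb0⟩ := (Submodule.ne_bot_iff _).1 h0
    have := zero_dvd_iff.1 (hcπ b hb)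
    have hc0 : c ≠ 0 := fun h ↦ hc (h ▸ zero_mem _)
    exact mul_ne_zero hc0 hb0 this
  have hA𝔭 (M : Type _) [AddCommGroup M] [Module A M] (e : (A ⧸ 𝔭) ≃ₗ[A] M) :
      ∀ b ∈ 𝔭, ∀ m : M, b • m = 0 := fun b hb m ↦ by
    obtain ⟨m, rfl⟩ := e.surjective m
    obtain ⟨m, rfl⟩ := Ideal.Quotient.mk_surjective m
    rw [← map_smul]
    have : b • Ideal.Quotient.mk 𝔭 m = Ideal.Quotient.mk 𝔭 (b * m) := rfl
    rw [this, Ideal.Quotient.eq_zero_iff_mem.2 (Ideal.mul_mem_right _ _ hb), map_zero]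
  have hq𝔭 (q : A) (hq : q ∉ 𝔭) : HasIdx k (A ⧸ 𝔭) q :=
    hasIdx_of_primes 𝔭 (hA𝔭 _ (LinearEquiv.refl A _)) q fun P hP hle hqP ↦
      (hA 𝔭 P inferInstance hP h0 (lt_of_le_of_ne hle fun h ↦ hq (h ▸ hqP))).2
  have ne0 {b : A} (hb : b ∉ 𝔭) : b ≠ 0 := fun h ↦ hb (h ▸ zero_mem _)
  -- the main claim
  let d := c * (x * (d₁ * (d₂ * s)))
  have hd : d ∉ 𝔭 := by
    simp only [d, Ideal.IsPrime.mul_mem_iff_mem_or_mem inferInstance]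
    tauto
  obtain ⟨e, he, hde⟩ := exists_meetProperly hA h0 hd
  suffices key : ∀ q ∉ 𝔭, (n : ℤ) ∣ a * idx k (A ⧸ 𝔭) (d * q) by
    have h1 := key 1 ((Ideal.ne_top_iff_one 𝔭).1 (Ideal.IsPrime.ne_top inferInstance))
    have h2 := key q hq
    rw [mul_one] at h1
    rw [idx_mul (hq𝔭 d hd) (hq𝔭 q hq), mul_add] at h2
    exact (dvd_add_right h1).1 h2
  intro q hq
  let g := e ^ n + d * q
  have hg𝔭 : g ∉ 𝔭 := fun hg ↦ by
    have := (Ideal.add_mem_iff_right _ (Ideal.pow_mem_of_mem _ he n hn.bot_lt)).1 hg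
    exact (Ideal.IsPrime.mul_mem_iff_mem_or_mem inferInstance).1 this |>.elim hd hq
  have hg0 : g ≠ 0 := ne0 hg𝔭
  have hge (P : Ideal A) (hP : P.IsPrime) (hdP : d ∈ P) (hgP : g ∈ P) : e ∈ P :=
    hP.mem_of_pow_mem n ((Ideal.add_mem_iff_left _ (Ideal.mul_mem_right q _ hdP)).1 hgP)
  have hdg : HasIdx k (A ⧸ Ideal.span {g}) d := hde.hasIdx hge
  have hπg : HasIdx k (A ⧸ Ideal.span {g}) π := by
    refine hasIdx_of_primes _ (span_smul_quotient g) π fun P hP hgP hπP ↦ ?_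
    rw [Ideal.span_singleton_le_iff_mem] at hgP
    by_cases hdP : d ∈ P
    · exact (hde P hP hdP (hge P hP hdP hgP)).2
    · have hle : 𝔭 ≤ P := fun b hb ↦ by
        have h1 : c * b ∈ P := Ideal.mem_of_dvd _ (hcπ b hb) hπP
        exact (hP.mem_or_mem h1).resolve_left fun hcP ↦ hdP (Ideal.mul_mem_right _ _ hcP)
      exact (hA 𝔭 P inferInstance hP h0 (lt_of_le_of_ne hle fun h ↦ hg𝔭 (h ▸ hgP))).2
  have dvd_d₁ : d₁ ∣ d := ⟨c * x * d₂ * s, by ring⟩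
  have dvd_d₂ : d₂ ∣ d := ⟨c * x * d₁ * s, by ring⟩
  have dvd_x : x ∣ d := ⟨c * d₁ * d₂ * s, by ring⟩
  have dvd_s : s ∣ d := ⟨c * x * d₁ * d₂, by ring⟩
  have dvd_c : c ∣ d := ⟨_, rfl⟩
  have hgd : d ∣ g - e ^ n := ⟨q, by simp [g]⟩
  -- the index of `π ^ a * d₂ / d₁` on `A / g` is divisible by `n`
  have h1 : (n : ℤ) ∣ idx k (A ⧸ Ideal.span {g}) (π ^ a * d₂) - idx k (A ⧸ Ideal.span {g}) d₁ := by
    have h2 : ∃ z : R, algebraMap A R (π ^ a * d₂) - z ^ n * algebraMap A R d₁ ∈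
        Ideal.span {algebraMap A R g} := by
      refine exists_sub_pow_mul_mem ?_ fun w hw ↦ ?_
      · rw [Ne, Ideal.span_singleton_eq_bot]
        exact (map_ne_zero_iff _ hinj).2 hg0
      · rw [Ideal.span_singleton_le_iff_mem] at hw
        refine h w ?_ fun hsw ↦ ?_
        · rintro rfl
          exact hg𝔭 ((h𝔭 g).2 hw)
        · let P := w.asIdeal.comap (algebraMap A R)
          have hdP : d ∈ P := Ideal.mem_of_dvd P dvd_s hsw
          have := (hde P inferInstance hdP (hge P inferInstance hdP hw)).1
          exact w.isPrime.ne_top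
            (Ideal.eq_top_of_isUnit_mem _ this (IsLocalization.Away.algebraMap_isUnit x))
    obtain ⟨z, hz⟩ := h2
    obtain ⟨m, y, hy⟩ := exists_pow_mul_sub_mem x hn (π ^ a * d₂) d₁ g ⊤ z fun b _ ↦
      Ideal.mul_mem_right _ _ hz
    refine dvd_idx_sub hn (X := x ^ m) (z := y) (fun t ↦ ?_) ((hπg.pow a).mul (hdg.of_dvd dvd_d₂))
      (hdg.of_dvd dvd_d₁) ((hdg.of_dvd dvd_x).pow m)
    rw [← sub_eq_zero, ← sub_smul]
    refine span_smul_quotient g _ ?_ t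
    simpa using hy 1 trivial
  have h3 : (n : ℤ) ∣ a * idx k (A ⧸ Ideal.span {g}) π := by
    rw [idx_mul (hπg.pow a) (hdg.of_dvd dvd_d₂), idx_pow hπg] at h1
    have h4 := dvd_idx_quotient (ne0 hd₁) hg0 hn (dvd_d₁.trans hgd) (hdg.of_dvd dvd_d₁)
    have h5 := dvd_idx_quotient (ne0 hd₂) hg0 hn (dvd_d₂.trans hgd) (hdg.of_dvd dvd_d₂)
    obtain ⟨u, hu⟩ := dvd_sub (dvd_add h1 h4) h5
    exact ⟨u, by linear_combination hu⟩
  -- pass to `A / π`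
  obtain ⟨h7, h8⟩ := hπg.symm hπ0 hg0
  have hle : Ideal.span {π} ≤ 𝔭 := (Ideal.span_singleton_le_iff_mem 𝔭).2 hπ
  let S : Submodule A (A ⧸ Ideal.span {π}) := Submodule.map (Submodule.mkQ (Ideal.span {π})) 𝔭
  let E : ((A ⧸ Ideal.span {π}) ⧸ S) ≃ₗ[A] (A ⧸ 𝔭) :=
    Submodule.quotientQuotientEquivQuotient (Ideal.span {π}) 𝔭 hle
  have hS : ∀ b ∈ Ideal.span {d}, ∀ m : S, b • m = 0 := by
    rintro b hb ⟨_, ⟨m, hm, rfl⟩⟩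
    refine Subtype.ext ?_
    change b • Submodule.mkQ _ m = 0
    rw [← map_smul, Submodule.mkQ_apply, Submodule.Quotient.mk_eq_zero]
    refine Ideal.mem_span_singleton.2 ((hcπ m hm).trans ?_)
    exact mul_dvd_mul_right (dvd_c.trans (Ideal.mem_span_singleton.1 hb)) m
  have hSe : HasIdx k S e := hasIdx_of_primes _ hS e fun P hP hdP heP ↦
    (hde P hP ((Ideal.span_singleton_le_iff_mem P).1 hdP) heP).2
  have hSg := (hSe.pow n).of_smul_eq (b := g) fun m ↦ by
    rw [← sub_eq_zero, ← sub_smul]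
    refine hS _ (Ideal.mem_span_singleton.2 ?_) m
    exact ⟨-q, by simp [g]⟩
  have hQg := (hq𝔭 (d * q) fun h ↦
    ((Ideal.IsPrime.mul_mem_iff_mem_or_mem inferInstance).1 h).elim hd hq).of_smul_eq (b := g)
    fun m ↦ by
      rw [← sub_eq_zero, ← sub_smul]
      refine hA𝔭 _ (LinearEquiv.refl A _) _ ?_ m
      have : d * q - g = - e ^ n := by simp [g]
      rw [this]
      exact neg_mem (Ideal.pow_mem_of_mem _ he n hn.bot_lt)
  have hQg' := hQg.1.congr E.symm
  have h9 := (hSg.1.add S hQg'.1).2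
  rw [hSg.2, idx_pow hSe, hQg'.2, hQg.2] at h9
  rw [← h8, h9, mul_add] at h3
  exact (dvd_add_right ⟨a * idx k S e, by ring⟩).1 h3

/-- The difference of the indices along `𝔭` of `f₁` and `f₂` is divisible by `n`, if `f₁ / f₂` is
an `n`-th power at almost all places. -/
theorem dvd_idx_sub_of_isPowerAt (hx : x ≠ 0) (hA : IsSurfaceLike k x) {n : ℕ} (hn : 2 ≤ n)
    (v : HeightOneSpectrum R) (𝔭 : Ideal A) [𝔭.IsPrime]
    (h𝔭 : ∀ a, a ∈ 𝔭 ↔ algebraMap A R a ∈ v.asIdeal) (h0 : 𝔭 ≠ ⊥)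
    {π f₁ f₂ s : A} (hπ : π ∈ 𝔭) (hπ2 : algebraMap A R π ∉ v.asIdeal ^ 2)
    (hf₁ : f₁ ∉ 𝔭) (hf₂ : f₂ ∉ 𝔭) (hs : s ∉ 𝔭)
    (h : ∀ w : HeightOneSpectrum R, w ≠ v → algebraMap A R s ∉ w.asIdeal →
      IsPowerAt n (algebraMap A R f₁) (algebraMap A R f₂) w) :
    (n : ℤ) ∣ idx k (A ⧸ 𝔭) f₁ - idx k (A ⧸ 𝔭) f₂ := by
  have hn0 : n ≠ 0 := by omega
  have hx𝔭 : x ∉ 𝔭 := fun hx' ↦ v.isPrime.ne_top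
    (Ideal.eq_top_of_isUnit_mem _ ((h𝔭 x).1 hx') (IsLocalization.Away.algebraMap_isUnit x))
  have hinj : Function.Injective (algebraMap A R) :=
    IsLocalization.injective R (powers_le_nonZeroDivisors_of_noZeroDivisors hx)
  have hA𝔭 : ∀ b ∈ 𝔭, ∀ m : A ⧸ 𝔭, b • m = 0 := fun b hb m ↦ by
    obtain ⟨m, rfl⟩ := Ideal.Quotient.mk_surjective m
    have : b • Ideal.Quotient.mk 𝔭 m = Ideal.Quotient.mk 𝔭 (b * m) := rfl
    rw [this, Ideal.Quotient.eq_zero_iff_mem.2 (Ideal.mul_mem_right _ _ hb)]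
  have hq𝔭 (q : A) (hq : q ∉ 𝔭) : HasIdx k (A ⧸ 𝔭) q :=
    hasIdx_of_primes 𝔭 hA𝔭 q fun P hP hle hqP ↦
      (hA 𝔭 P inferInstance hP h0 (lt_of_le_of_ne hle fun h ↦ hq (h ▸ hqP))).2
  have ne0 {b : A} (hb : b ∉ 𝔭) : b ≠ 0 := fun h ↦ hb (h ▸ zero_mem _)
  let d := x * (f₁ * (f₂ * s))
  have hd : d ∉ 𝔭 := by
    simp only [d, Ideal.IsPrime.mul_mem_iff_mem_or_mem inferInstance]
    tauto
  have dvd_f₁ : f₁ ∣ d := ⟨x * f₂ * s, by ring⟩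
  have dvd_f₂ : f₂ ∣ d := ⟨x * f₁ * s, by ring⟩
  have dvd_x : x ∣ d := ⟨_, rfl⟩
  have dvd_s : s ∣ d := ⟨x * f₁ * f₂, by ring⟩
  obtain ⟨e, he, hde⟩ := exists_meetProperly hA h0 hd
  let g := e ^ n + d * π
  have hgd : d ∣ g - e ^ n := ⟨π, by simp [g]⟩
  have hg𝔭 : g ∈ 𝔭 := add_mem (Ideal.pow_mem_of_mem _ he n hn0.bot_lt) (Ideal.mul_mem_left _ _ hπ)
  have hg2 : algebraMap A R g ∉ v.asIdeal ^ 2 := by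
    intro hg
    simp only [g, map_add, map_mul, map_pow] at hg
    have h1 : algebraMap A R e ^ n ∈ v.asIdeal ^ 2 :=
      Ideal.pow_le_pow_right hn (Ideal.pow_mem_pow ((h𝔭 e).1 he) n)
    have h2 := (Ideal.add_mem_iff_right _ h1).1 hg
    rcases (v.isPrime.mul_mem_pow _ h2) with h | h
    · exact hd ((h𝔭 d).2 h)
    · exact hπ2 h
  have hg0 : g ≠ 0 := fun h ↦ hg2 (by rw [h, map_zero]; exact zero_mem _)
  have hge (P : Ideal A) (hP : P.IsPrime) (hdP : d ∈ P) (hgP : g ∈ P) : e ∈ P :=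
    hP.mem_of_pow_mem n ((Ideal.add_mem_iff_left _ (Ideal.mul_mem_right π _ hdP)).1 hgP)
  have hdg : HasIdx k (A ⧸ Ideal.span {g}) d := hde.hasIdx hge
  have hle : Ideal.span {g} ≤ 𝔭 := (Ideal.span_singleton_le_iff_mem 𝔭).2 hg𝔭
  let S : Submodule A (A ⧸ Ideal.span {g}) := Submodule.map (Submodule.mkQ (Ideal.span {g})) 𝔭
  let E : ((A ⧸ Ideal.span {g}) ⧸ S) ≃ₗ[A] (A ⧸ 𝔭) :=
    Submodule.quotientQuotientEquivQuotient (Ideal.span {g}) 𝔭 hle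
  have hdS : HasIdx k S d := hasIdx_of_primes (Ideal.span {g})
    (fun a ha m ↦ Subtype.ext (span_smul_quotient g a ha m)) d fun P hP hgP hdP ↦
      (hde P hP hdP (hge P hP hdP ((Ideal.span_singleton_le_iff_mem P).1 hgP))).2
  have hS : (n : ℤ) ∣ idx k S f₁ - idx k S f₂ := by
    have hv : Ideal.span {algebraMap A R g} ≤ v.asIdeal :=
      (Ideal.span_singleton_le_iff_mem _).2 ((h𝔭 g).1 hg𝔭)
    obtain ⟨J, hJ⟩ := Ideal.dvd_iff_le.2 hv
    have hJv : ¬ J ≤ v.asIdeal := fun hJv ↦ hg2 <| by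
      rw [← Ideal.span_singleton_le_iff_mem, hJ, pow_two]
      exact Ideal.mul_mono_right hJv
    have hJ0 : J ≠ ⊥ := fun h ↦ hJv (h ▸ bot_le)
    have h2 : ∃ z : R, algebraMap A R f₁ - z ^ n * algebraMap A R f₂ ∈ J := by
      refine exists_sub_pow_mul_mem hJ0 fun w hw ↦ h w ?_ fun hsw ↦ ?_
      · rintro rfl
        exact hJv hw
      · let P := w.asIdeal.comap (algebraMap A R)
        have hdP : d ∈ P := Ideal.mem_of_dvd P dvd_s hsw
        have hgP : g ∈ P := by
          refine hw (?_ : algebraMap A R g ∈ J)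
          rw [← Ideal.span_singleton_le_iff_mem, hJ]
          exact Ideal.mul_le_right (I := v.asIdeal) (J := J)
        have := (hde P inferInstance hdP (hge P inferInstance hdP hgP)).1
        exact w.isPrime.ne_top
          (Ideal.eq_top_of_isUnit_mem _ this (IsLocalization.Away.algebraMap_isUnit x))
    obtain ⟨z, hz⟩ := h2
    obtain ⟨m, y, hy⟩ := exists_pow_mul_sub_mem x hn0 f₁ f₂ g 𝔭 z fun b hb ↦ by
      rw [hJ, mul_comm v.asIdeal]
      exact Ideal.mul_mem_mul hz ((h𝔭 b).1 hb)
    refine dvd_idx_sub hn0 (X := x ^ m) (z := y) (fun t ↦ ?_) (hdS.of_dvd dvd_f₁)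
      (hdS.of_dvd dvd_f₂) ((hdS.of_dvd dvd_x).pow m)
    obtain ⟨_, ⟨b, hb, rfl⟩⟩ := t
    rw [← sub_eq_zero, ← sub_smul]
    refine Subtype.ext ?_
    change (_ : A) • Submodule.mkQ _ b = 0
    rw [← map_smul, Submodule.mkQ_apply, Submodule.Quotient.mk_eq_zero]
    exact hy b hb
  have main (f : A) (hf : f ∉ 𝔭) (hfd : f ∣ d) : (n : ℤ) ∣ idx k S f + idx k (A ⧸ 𝔭) f := by
    have h1 := dvd_idx_quotient (ne0 hf) hg0 hn0 (hfd.trans hgd) (hdg.of_dvd hfd)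
    have h2 := (hq𝔭 f hf).congr E.symm
    have h3 := ((hdS.of_dvd hfd).add S h2.1).2
    rwa [h3, h2.2] at h1
  obtain ⟨u, hu⟩ := dvd_sub (dvd_sub (main f₁ hf₁ dvd_f₁) (main f₂ hf₂ dvd_f₂)) hS
  exact ⟨u, by linear_combination hu⟩

end Core

section AdicFinite

open Submodule

variable {D M : Type*} [CommRing D] (I : Ideal D) [AddCommGroup M] [Module D M]

lemma isPrecomplete_pi {ι : Type*} [Finite ι] [IsPrecomplete I D] : IsPrecomplete I (ι → D) := by
  classical
  have := Fintype.ofFinite ι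
  rw [← AdicCompletion.of_surjective_iff]
  intro y
  choose z hz using fun i ↦ AdicCompletion.of_surjective I D
    (AdicCompletion.piEquivOfFintype I (fun _ : ι ↦ D) y i)
  refine ⟨z, (AdicCompletion.piEquivOfFintype I (fun _ : ι ↦ D)).injective ?_⟩
  funext i
  rw [← hz]
  simp only [AdicCompletion.piEquivOfFintype_apply, AdicCompletion.pi, LinearMap.pi_apply,
    AdicCompletion.map_of, LinearMap.proj_apply]

lemma isPrecomplete_of_finite [IsPrecomplete I D] [Module.Finite D M] : IsPrecomplete I M := by
  obtain ⟨n, f, hf⟩ := Module.Finite.exists_fin' D M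
  have := isPrecomplete_pi I (ι := Fin n)
  rw [← AdicCompletion.of_surjective_iff]
  intro y
  obtain ⟨x, rfl⟩ := AdicCompletion.map_surjective I hf y
  obtain ⟨z, rfl⟩ := AdicCompletion.of_surjective I _ x
  exact ⟨f z, (AdicCompletion.map_of I f z).symm⟩

lemma finite_of_finite_quotient [IsPrecomplete I D] [IsHausdorff I M]
    [Module.Finite D (M ⧸ (I • ⊤ : Submodule D M))] : Module.Finite D M := by
  obtain ⟨n, g, hg⟩ := Module.Finite.exists_fin' D (M ⧸ (I • ⊤ : Submodule D M))
  have := isPrecomplete_pi I (ι := Fin n)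
  obtain ⟨f, hf⟩ := Module.projective_lifting_property (mkQ (I • ⊤ : Submodule D M)) g
    (mkQ_surjective _)
  exact Module.Finite.of_surjective f (surjective_of_mkQ_comp_surjective (I := I) (hf ▸ hg))

end AdicFinite

section CompleteDedekind

open Polynomial

variable {O : Type*} [CommRing O] {t : O}

lemma isLocalRing_of_isAdicComplete [IsDedekindDomain O] (ht0 : t ≠ 0) (ht : ¬ IsUnit t)
    [IsAdicComplete (Ideal.span {t}) O] : IsLocalRing O := by
  have hjac := IsAdicComplete.le_jacobson_bot (Ideal.span {t})
  have htM : ∀ M : Ideal O, M.IsMaximal → t ∈ M := fun M hM ↦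
    (Ideal.mem_sInf.1 (hjac (Ideal.mem_span_singleton_self t))) ⟨bot_le, hM⟩
  obtain ⟨M, hM, -⟩ := exists_max_ideal_of_mem_nonunits ht
  refine IsLocalRing.of_unique_max_ideal ⟨M, hM, fun N hN ↦ ?_⟩
  by_contra hne
  have hM0 : M ≠ ⊥ := fun h ↦ ht0 (by simpa [h] using htM M hM)
  have hI0 : Ideal.span {t} ≠ ⊥ := by simpa using ht0
  have hfin : FiniteMultiplicity M (Ideal.span {t}) :=
    FiniteMultiplicity.of_prime_left (Ideal.prime_of_isPrime hM0 hM.isPrime) hI0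
  obtain ⟨J, hJ, hMJ⟩ := hfin.exists_eq_pow_mul_and_not_dvd
  set m := multiplicity M (Ideal.span {t})
  have hk : m ≠ 0 := by
    intro h
    rw [h, pow_zero, one_mul] at hJ
    exact hMJ (Ideal.dvd_iff_le.2 (by rw [← hJ, Ideal.span_singleton_le_iff_mem]; exact htM M hM))
  have hJN : J ≤ N := by
    have h1 : M ^ m * J ≤ N := by
      rw [← hJ, Ideal.span_singleton_le_iff_mem]; exact htM N hN
    rcases (Ideal.IsPrime.mul_le hN.isPrime).1 h1 with h | h
    · exact absurd (hM.eq_of_le hN.ne_top (Ideal.IsPrime.le_of_pow_le (hP := hN.isPrime) h)).symm hne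
    · exact h
  have hcop : IsCoprime (M ^ m) J := by
    refine IsCoprime.pow_left ?_
    rw [Ideal.isCoprime_iff_sup_eq]
    exact hM.1.2 _ (lt_of_le_of_ne le_sup_left fun h ↦
      hMJ (Ideal.dvd_iff_le.2 (h ▸ le_sup_right)))
  obtain ⟨a, ha, b, hb, hab⟩ := Ideal.isCoprime_iff_exists.1 hcop
  have habt : a * b ∈ Ideal.span {t} := hJ ▸ Ideal.mul_mem_mul ha hb
  obtain ⟨e, he, hea⟩ := HenselianRing.is_henselian (I := Ideal.span {t}) (X ^ 2 - X : O[X])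
    (by monicity!) a (by
      have : eval a (X ^ 2 - X : O[X]) = - (a * b) := by
        rw [← sub_eq_iff_eq_add'.2 hab.symm]; simp; ring
      rw [this]; exact neg_mem habt) (by
      refine IsUnit.of_mul_eq_one (Ideal.Quotient.mk _ (2 * a - 1)) ?_
      have : eval a (derivative (X ^ 2 - X : O[X])) = 2 * a - 1 := by simp [one_add_one_eq_two]
      rw [this, ← map_mul, ← map_one (Ideal.Quotient.mk _), Ideal.Quotient.eq]
      have : (2 * a - 1) * (2 * a - 1) - 1 = - 4 * (a * b) := by
        rw [← sub_eq_iff_eq_add'.2 hab.symm]; ring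
      rw [this]
      exact Ideal.mul_mem_left _ _ habt)
  have he' : e = 0 ∨ e = 1 := by
    have : e * (e - 1) = 0 := by
      have := he.eq_zero
      simp at this
      linear_combination this
    rcases mul_eq_zero.1 this with h | h
    · exact .inl h
    · exact .inr (sub_eq_zero.1 h)
  have hle : ∀ Q : Ideal O, Q.IsMaximal → Ideal.span {t} ≤ Q := fun Q hQ ↦ by
    rw [Ideal.span_singleton_le_iff_mem]; exact htM Q hQ
  rcases he' with rfl | rfl
  · refine hN.ne_top ((Ideal.eq_top_iff_one _).2 ?_)
    rw [← hab]
    exact add_mem (by simpa using hle N hN hea) (hJN hb)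
  · refine hM.ne_top ((Ideal.eq_top_iff_one _).2 ?_)
    rw [← hab] at hea ⊢
    exact add_mem (Ideal.pow_le_self hk ha) (by simpa using hle M hM hea)



lemma exists_pow_eq_of_isUnit {k : Type*} [Field k] [IsAlgClosed k] [CharZero k] [Algebra k O]
    [IsLocalRing O] (hres : Function.Surjective (algebraMap k (IsLocalRing.ResidueField O)))
    (I : Ideal O) [HenselianRing O I] (hI : ∀ a ∈ IsLocalRing.maximalIdeal O, ∃ N : ℕ, a ^ N ∈ I)
    {n : ℕ} (hn : n ≠ 0) {u : O} (hu : IsUnit u) : ∃ w : O, w ^ n = u := by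
  have hnk : IsUnit (n : k) := by simpa using hn
  obtain ⟨c, hc⟩ := hres (IsLocalRing.residue O u)
  have hc0 : c ≠ 0 := by
    rintro rfl
    rw [map_zero] at hc
    exact (hu.map (IsLocalRing.residue O)).ne_zero hc.symm
  obtain ⟨b, rfl⟩ := IsAlgClosed.exists_pow_nat_eq c (Nat.pos_of_ne_zero hn)
  have hb : IsUnit b := by
    rw [isUnit_iff_ne_zero]
    rintro rfl
    simp [hn] at hc0
  have hmem : (algebraMap k O b) ^ n - u ∈ IsLocalRing.maximalIdeal O := by
    rw [← IsLocalRing.residue_eq_zero_iff, map_sub, sub_eq_zero, ← hc, map_pow, map_pow]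
    rfl
  obtain ⟨N, hN⟩ := hI _ hmem
  let q := Ideal.Quotient.mk I
  obtain ⟨r, ⟨-, hr⟩, -⟩ := Polynomial.existsUnique_nilpotent_sub_and_aeval_eq_zero
    (P := (X ^ n - C (q u) : (O ⧸ I)[X])) (x := q (algebraMap k O b)) (by
      refine ⟨N, ?_⟩
      simp only [map_sub, map_pow, aeval_X, aeval_C]
      rw [← Ideal.Quotient.eq_zero_iff_mem] at hN
      rwa [map_pow, map_sub, map_pow] at hN) (by
      simp only [derivative_sub, derivative_X_pow, derivative_C, sub_zero, map_mul, map_pow,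
        aeval_X, map_natCast]
      refine IsUnit.mul ?_ ((hb.map (q.comp (algebraMap k O))).pow _)
      simpa using hnk.map (q.comp (algebraMap k O)))
  obtain ⟨r, rfl⟩ := Ideal.Quotient.mk_surjective r
  have hr' : q r ^ n = q u := by simpa [sub_eq_zero, q] using hr
  have hru : IsUnit (q r) := by
    rw [← isUnit_pow_iff hn, hr']
    exact hu.map q
  obtain ⟨w, hw, -⟩ := HenselianRing.is_henselian (I := I) (X ^ n - C u : O[X])
    (monic_X_pow_sub_C u hn) r (by
      rw [← Ideal.Quotient.eq_zero_iff_mem]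
      simpa [sub_eq_zero, q] using hr') (by
      simp only [derivative_sub, derivative_X_pow, derivative_C, sub_zero, eval_mul, eval_pow,
        eval_X, eval_natCast, map_mul, map_pow, map_natCast]
      exact IsUnit.mul (by simpa using hnk.map (q.comp (algebraMap k O))) (hru.pow _))
  exact ⟨w, by simpa [sub_eq_zero] using hw.eq_zero⟩

end CompleteDedekind

section DVR

open IsLocalRing

variable {k O : Type*} [Field k] [CommRing O] [IsDomain O] [IsDiscreteValuationRing O] [Algebra k O]

lemma hasIdx_irreducible (hres : Function.Surjective (algebraMap k (ResidueField O)))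
    {ϖ : O} (hϖ : Irreducible ϖ) : HasIdx k O ϖ ∧ idx k O ϖ = 1 := by
  let φ : O →ₗ[k] ResidueField O := (IsScalarTower.toAlgHom k O (ResidueField O)).toLinearMap
  have hφ : Function.Surjective φ := residue_surjective
  have hker : LinearMap.range (Algebra.lsmul k k O ϖ) = LinearMap.ker φ := by
    ext a
    have : a ∈ LinearMap.ker φ ↔ a ∈ maximalIdeal O := residue_eq_zero_iff a
    rw [this, hϖ.maximalIdeal_eq, Ideal.mem_span_singleton']
    simp [mul_comm]
  let e : k ≃ₗ[k] ResidueField O := LinearEquiv.ofBijective (Algebra.linearMap k (ResidueField O))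
    ⟨(algebraMap k (ResidueField O)).injective, hres⟩
  let e' : (O ⧸ LinearMap.range (Algebra.lsmul k k O ϖ)) ≃ₗ[k] k :=
    (Submodule.quotEquivOfEq _ _ hker).trans ((φ.quotKerEquivOfSurjective hφ).trans e.symm)
  have hbot : LinearMap.ker (Algebra.lsmul k k O ϖ) = ⊥ :=
    LinearMap.ker_eq_bot.2 (mul_right_injective₀ hϖ.ne_zero)
  have : Module.Finite k (O ⧸ LinearMap.range (Algebra.lsmul k k O ϖ)) :=
    Module.Finite.equiv e'.symm
  refine ⟨⟨?_, this⟩, ?_⟩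
  · rw [hbot]; infer_instance
  · rw [idx, LinearMap.coindex, hbot, e'.finrank_eq]
    simp

lemma hasIdx_unit_mul_pow (hres : Function.Surjective (algebraMap k (ResidueField O)))
    {ϖ : O} (hϖ : Irreducible ϖ) (u : Oˣ) (m : ℕ) :
    HasIdx k O (u * ϖ ^ m) ∧ idx k O (u * ϖ ^ m) = m := by
  obtain ⟨h1, h2⟩ := hasIdx_irreducible hres hϖ
  have hu := hasIdx_of_bijective (k := k) (M := O) (u : O)
    ⟨mul_right_injective₀ u.ne_zero, fun b ↦ ⟨(↑u⁻¹ : O) * b, by simp⟩⟩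
  refine ⟨hu.1.mul (h1.pow m), ?_⟩
  rw [idx_mul hu.1 (h1.pow m), hu.2, idx_pow h1, h2]
  simp

lemma exists_mul_pow_eq_of_dvd_idx (hres : Function.Surjective (algebraMap k (ResidueField O)))
    {n : ℕ} (hu : ∀ u : O, IsUnit u → ∃ w : O, w ^ n = u) {a b : O} (ha : a ≠ 0) (hb : b ≠ 0)
    (h : (n : ℤ) ∣ idx k O a - idx k O b) : ∃ z₁ z₂ : O, z₂ ≠ 0 ∧ a * z₂ ^ n = z₁ ^ n * b := by
  obtain ⟨ϖ, hϖ⟩ := IsDiscreteValuationRing.exists_irreducible O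
  obtain ⟨l, u, rfl⟩ := IsDiscreteValuationRing.eq_unit_mul_pow_irreducible ha hϖ
  obtain ⟨m, v, rfl⟩ := IsDiscreteValuationRing.eq_unit_mul_pow_irreducible hb hϖ
  rw [(hasIdx_unit_mul_pow hres hϖ u l).2, (hasIdx_unit_mul_pow hres hϖ v m).2] at h
  obtain ⟨r, hr⟩ := hu u u.isUnit
  obtain ⟨s, hs⟩ := hu v v.isUnit
  have hs0 : s ^ n ≠ 0 := hs ▸ v.ne_zero
  rw [← hr, ← hs]
  have hsn : n ≠ 0 → s ≠ 0 := fun hn h ↦ by simp [h, hn] at hs0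
  rcases eq_or_ne n 0 with rfl | hn
  · have : (l : ℤ) = m := by simpa [sub_eq_zero] using h
    exact ⟨1, 1, one_ne_zero, by rw [Int.natCast_inj.1 this]; simp⟩
  obtain ⟨c, hc⟩ := h
  rcases le_total 0 c with h0 | h0
  · lift c to ℕ using h0
    have : l = n * c + m := by zify; linarith
    refine ⟨r * ϖ ^ c, s, hsn hn, ?_⟩
    rw [this]; ring
  · obtain ⟨d, rfl⟩ : ∃ d : ℕ, c = - d := ⟨c.natAbs, by omega⟩
    have : m = n * d + l := by zify; linarith
    refine ⟨r, s * ϖ ^ d, mul_ne_zero (hsn hn) (pow_ne_zero _ hϖ.ne_zero), ?_⟩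
    rw [this]; ring

end DVR

section Curve

open IsLocalRing PowerSeries

variable {k : Type*} [Field k]

instance : FaithfulSMul k k⟦X⟧ := (faithfulSMul_iff_algebraMap_injective _ _).2 (by
  intro a b h
  simpa using congrArg (coeff 0) h)

lemma finite_quotient_span_X : Module.Finite k (k⟦X⟧ ⧸ (Ideal.span {(X : k⟦X⟧)})) := by
  refine Module.Finite.of_surjective
    (Algebra.linearMap k (k⟦X⟧ ⧸ (Ideal.span {(X : k⟦X⟧)}))) fun y ↦ ?_
  obtain ⟨y, rfl⟩ := Ideal.Quotient.mk_surjective y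
  refine ⟨constantCoeff y, ?_⟩
  change Ideal.Quotient.mk _ (algebraMap k k⟦X⟧ _) = _
  rw [Ideal.Quotient.eq, Ideal.mem_span_singleton, X_dvd_iff]
  simp

section

variable {O : Type*} [CommRing O] [IsDedekindDomain O] [Algebra k O] [Algebra k⟦X⟧ O]
  [IsScalarTower k k⟦X⟧ O] [Module.Finite k⟦X⟧ O]

lemma isDiscreteValuationRing_of_finite [IsAlgClosed k] [CharZero k]
    (ht0 : algebraMap k⟦X⟧ O X ≠ 0) (ht : ¬ IsUnit (algebraMap k⟦X⟧ O X)) :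
    ∃ _ : IsDiscreteValuationRing O, Function.Surjective (algebraMap k (ResidueField O)) ∧
      ∀ n : ℕ, n ≠ 0 → ∀ u : O, IsUnit u → ∃ w : O, w ^ n = u := by
  set t := algebraMap k⟦X⟧ O X with ht_def
  have hmap : (Ideal.span {(X : k⟦X⟧)}).map (algebraMap k⟦X⟧ O) = Ideal.span {t} := by
    rw [Ideal.map_span, Set.image_singleton]
  have htop : Ideal.span {t} ≠ ⊤ := by rwa [Ne, Ideal.span_singleton_eq_top]
  have h1 : IsPrecomplete (Ideal.span {t}) O := by
    rw [← hmap, IsPrecomplete.map_algebraMap_iff]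
    exact isPrecomplete_of_finite _
  have h2 : IsHausdorff (Ideal.span {t}) O := IsHausdorff.of_isDomain _ htop
  have h3 : IsAdicComplete (Ideal.span {t}) O := ⟨⟩
  have h4 : IsLocalRing O := isLocalRing_of_isAdicComplete ht0 ht
  have hfield : ¬ IsField O := fun h ↦ ht (h.mul_inv_cancel ht0 |>.elim fun b hb ↦ .of_mul_eq_one b hb)
  have h5 : IsDiscreteValuationRing O :=
    ((IsDiscreteValuationRing.TFAE O hfield).out 0 2).2 ‹IsDedekindDomain O›
  have hfin : Module.Finite k (O ⧸ Ideal.span {t}) := by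
    have := finite_quotient_span_X (k := k)
    refine finite_of_smul_eq_zero (A := k⟦X⟧) (Ideal.span {X}) fun a ha m ↦ ?_
    obtain ⟨b, rfl⟩ := Ideal.mem_span_singleton'.1 ha
    obtain ⟨m, rfl⟩ := Ideal.Quotient.mk_surjective m
    rw [Algebra.smul_def, map_mul]
    have : algebraMap k⟦X⟧ (O ⧸ Ideal.span {t}) X = 0 := by
      change Ideal.Quotient.mk _ t = 0
      rw [Ideal.Quotient.eq_zero_iff_mem]
      exact Ideal.mem_span_singleton_self t
    rw [this]; simp
  have hfin' : Module.Finite k (ResidueField O) := by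
    have hle : Ideal.span {t} ≤ maximalIdeal O := le_maximalIdeal htop
    exact Module.Finite.of_surjective (Ideal.Quotient.factorₐ k hle).toLinearMap
      (Ideal.Quotient.factor_surjective hle)
  have hres : Function.Surjective (algebraMap k (ResidueField O)) :=
    (IsAlgClosed.algebraMap_bijective_of_isIntegral).2
  refine ⟨h5, hres, fun n hn u hu ↦ ?_⟩
  refine exists_pow_eq_of_isUnit hres (Ideal.span {t}) (fun a ha ↦ ?_) hn hu
  obtain ⟨ϖ, hϖ⟩ := IsDiscreteValuationRing.exists_irreducible O
  obtain ⟨l, hl⟩ := IsDiscreteValuationRing.associated_pow_irreducible ht0 hϖ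
  refine ⟨l, Ideal.mem_span_singleton.2 (hl.dvd.trans (pow_dvd_pow_of_dvd ?_ l))⟩
  rwa [hϖ.maximalIdeal_eq, Ideal.mem_span_singleton] at ha

end

variable {C : Type*} [CommRing C] [IsDomain C] [IsNoetherianRing C] [Algebra k C] [Algebra k⟦X⟧ C]
  [IsScalarTower k k⟦X⟧ C]

lemma finite_of_finite_quotient_prime (ht : ¬ IsUnit (algebraMap k⟦X⟧ C X))
    (ht0 : algebraMap k⟦X⟧ C X ≠ 0)
    (hC : ∀ P : Ideal C, P.IsPrime → P ≠ ⊥ → Module.Finite k (C ⧸ P)) :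
    Module.Finite k⟦X⟧ C := by
  have hmap : (Ideal.span {(X : k⟦X⟧)}).map (algebraMap k⟦X⟧ C) =
      Ideal.span {algebraMap k⟦X⟧ C X} := by
    rw [Ideal.map_span, Set.image_singleton]
  have htop : Ideal.span {algebraMap k⟦X⟧ C X} ≠ ⊤ := by rwa [Ne, Ideal.span_singleton_eq_top]
  have h2 : IsHausdorff (Ideal.span {(X : k⟦X⟧)}) C := by
    rw [← IsHausdorff.map_algebraMap_iff (S := C), hmap]
    exact IsHausdorff.of_isDomain _ htop
  have h3 : Module.Finite k (C ⧸ Ideal.span {algebraMap k⟦X⟧ C X}) := by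
    refine finite_quotient_of_forall_prime _ fun P hP hle ↦ hC P hP ?_
    rintro rfl
    rw [Ideal.span_singleton_le_iff_mem] at hle
    exact ht0 hle
  have h4 : Module.Finite k⟦X⟧ (C ⧸ Ideal.span {algebraMap k⟦X⟧ C X}) :=
    Module.Finite.of_restrictScalars_finite k _ _
  have h5 : Module.Finite k⟦X⟧ (C ⧸ ((Ideal.span {(X : k⟦X⟧)}) • ⊤ : Submodule k⟦X⟧ C)) := by
    rw [Ideal.smul_top_eq_map, hmap]
    exact h4
  exact finite_of_finite_quotient (Ideal.span {(X : k⟦X⟧)})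

omit [IsNoetherianRing C] [Algebra k C] [IsScalarTower k k⟦X⟧ C] in
lemma algebraMap_injective_of_X_ne_zero (ht0 : algebraMap k⟦X⟧ C X ≠ 0) :
    Function.Injective (algebraMap k⟦X⟧ C) := by
  rw [injective_iff_map_eq_zero]
  intro a ha
  by_contra h0
  obtain ⟨n, hn⟩ := IsDiscreteValuationRing.associated_pow_irreducible h0 X_irreducible
  obtain ⟨b, hb⟩ := hn.dvd
  refine pow_ne_zero n ht0 ?_
  rw [← map_pow, hb, map_mul, ha, zero_mul]

omit [IsNoetherianRing C] [Algebra k C] [IsScalarTower k k⟦X⟧ C] in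
/-- The normalization of a curve over `k` which is finite over `k⟦X⟧`. -/
lemma finite_integralClosure [CharZero k] [Module.Finite k⟦X⟧ C] [FaithfulSMul k⟦X⟧ C] :
    IsDedekindDomain (integralClosure C (FractionRing C)) ∧
      Module.Finite k⟦X⟧ (integralClosure C (FractionRing C)) := by
  let D := k⟦X⟧
  let L := FractionRing C
  have : CharZero D := charZero_of_injective_algebraMap (FaithfulSMul.algebraMap_injective k D)
  let : Algebra (FractionRing D) L := FractionRing.liftAlgebra D L
  have : FiniteDimensional (FractionRing D) L := .of_isLocalization D C (nonZeroDivisors D)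
  have : CharZero (FractionRing D) :=
    charZero_of_injective_algebraMap (IsFractionRing.injective D (FractionRing D))
  have : IsIntegralClosure (integralClosure C L) D L := by
    refine ⟨Subtype.val_injective, fun {x} ↦ ⟨fun h ↦ ⟨⟨x, h.tower_top⟩, rfl⟩, ?_⟩⟩
    rintro ⟨y, rfl⟩
    exact isIntegral_trans (R := D) (A := C) _ y.2
  exact ⟨IsIntegralClosure.isDedekindDomain D (FractionRing D) L _,
    IsIntegralClosure.finite D (FractionRing D) L _⟩

omit [IsDomain C] [IsNoetherianRing C] [Algebra k⟦X⟧ C] [IsScalarTower k k⟦X⟧ C] in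
lemma lsmul_algebraMap {O : Type*} [CommRing O] [Algebra k O] [Algebra C O]
    [IsScalarTower k C O] (c : C) :
    Algebra.lsmul k k O (algebraMap C O c) = Algebra.lsmul k k O c := by
  ext; simp [Algebra.smul_def]

omit [Algebra k⟦X⟧ C] [IsScalarTower k k⟦X⟧ C] in
lemma idx_finite_birational {O : Type*} [CommRing O] [IsDomain O] [Algebra k O] [Algebra C O]
    [IsScalarTower k C O] [Module.Finite C O] [FaithfulSMul C O]
    (hC : ∀ P : Ideal C, P.IsPrime → P ≠ ⊥ → Module.Finite k (C ⧸ P))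
    (hO : ∀ o : O, ∃ a b : C, b ≠ 0 ∧ algebraMap C O b * o = algebraMap C O a)
    {c : C} (hc : c ≠ 0) :
    HasIdx k O (algebraMap C O c) ∧ idx k O (algebraMap C O c) = idx k C c := by
  have hinj := FaithfulSMul.algebraMap_injective C O
  let S : Submodule C O := LinearMap.range (Algebra.linearMap C O)
  let e : C ≃ₗ[C] S := LinearEquiv.ofInjective (Algebra.linearMap C O) hinj
  have hC' : HasIdx k C c := hasIdx_of_primes ⊥ (by simp) c fun P hP _ hcP ↦
    hC P hP (by rintro rfl; exact hc hcP)
  obtain ⟨h1, h2⟩ := hC'.congr e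
  obtain ⟨d, hd0, hd⟩ : ∃ d : C, d ≠ 0 ∧ ∀ o : O, d • o ∈ S := by
    obtain ⟨s, hs⟩ := (inferInstance : Module.Finite C O)
    choose a b hb hab using hO
    refine ⟨∏ i ∈ s, b i, Finset.prod_ne_zero_iff.2 fun i _ ↦ hb i, fun o ↦ ?_⟩
    have : (⊤ : Submodule C O) ≤ S.comap (LinearMap.lsmul C O (∏ i ∈ s, b i)) := by
      rw [← hs, Submodule.span_le]
      intro i hi
      obtain ⟨r, hr⟩ := Finset.dvd_prod_of_mem b hi
      refine ⟨r * a i, ?_⟩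
      simp only [Algebra.linearMap_apply, map_mul, LinearMap.lsmul_apply, hr, Algebra.smul_def]
      rw [← hab]; ring
    exact this trivial
  have hfin : Module.Finite k (C ⧸ Ideal.span {d}) :=
    finite_quotient_of_forall_prime _ fun P hP hle ↦ hC P hP (by
      rintro rfl
      rw [Ideal.span_singleton_le_iff_mem] at hle
      exact hd0 hle)
  have hfin' : Module.Finite k (O ⧸ S) := by
    refine finite_of_smul_eq_zero (A := C) (Ideal.span {d}) fun a ha m ↦ ?_
    obtain ⟨b, rfl⟩ := Ideal.mem_span_singleton'.1 ha
    obtain ⟨m, rfl⟩ := Submodule.mkQ_surjective _ m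
    rw [mul_smul, ← map_smul, Submodule.mkQ_apply, (Submodule.Quotient.mk_eq_zero S).2 (hd m), smul_zero]
  obtain ⟨h3, h4⟩ := hasIdx_of_finite (k := k) (M := O ⧸ S) c
  obtain ⟨h5, h6⟩ := HasIdx.add S h1 h3
  rw [HasIdx, idx, lsmul_algebraMap]
  refine ⟨h5, ?_⟩
  change idx k O c = _
  rw [h6, h4, h2, add_zero]

/-- On a one-dimensional local curve, the index detects divisibility by `n`, and takes the
value one. -/
theorem idx_curve [IsAlgClosed k] [CharZero k]
    (ht : ¬ IsUnit (algebraMap k⟦X⟧ C X)) (ht0 : algebraMap k⟦X⟧ C X ≠ 0)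
    (hC : ∀ P : Ideal C, P.IsPrime → P ≠ ⊥ → Module.Finite k (C ⧸ P)) :
    (∀ (n : ℕ) (a b : C), n ≠ 0 → a ≠ 0 → b ≠ 0 → (n : ℤ) ∣ idx k C a - idx k C b →
      ∃ z₁ z₂ : C, z₂ ≠ 0 ∧ a * z₂ ^ n = z₁ ^ n * b) ∧
    ∃ a b : C, a ≠ 0 ∧ b ≠ 0 ∧ idx k C a - idx k C b = 1 := by
  have : Module.Finite k⟦X⟧ C := finite_of_finite_quotient_prime ht ht0 hC
  have : FaithfulSMul k⟦X⟧ C :=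
    (faithfulSMul_iff_algebraMap_injective _ _).2 (algebraMap_injective_of_X_ne_zero ht0)
  obtain ⟨h1, h2⟩ := finite_integralClosure (k := k) (C := C)
  set O := integralClosure C (FractionRing C)
  have hCO : Module.Finite C O := Module.Finite.of_restrictScalars_finite k⟦X⟧ C O
  have hinj : Function.Injective (algebraMap C O) := FaithfulSMul.algebraMap_injective C O
  have htO : algebraMap k⟦X⟧ O X = algebraMap C O (algebraMap k⟦X⟧ C X) :=
    IsScalarTower.algebraMap_apply _ _ _ _
  obtain ⟨h3, hres, hpow⟩ := isDiscreteValuationRing_of_finite (k := k) (O := O)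
    (by rw [htO]; exact (map_ne_zero_iff _ hinj).2 ht0)
    (by rw [htO]; exact fun h ↦ ht (isUnit_of_map_unit (algebraMap C O) _ h))
  have hO (o : O) : ∃ a b : C, b ≠ 0 ∧ algebraMap C O b * o = algebraMap C O a := by
    obtain ⟨a, b, hb, hab⟩ := IsFractionRing.div_surjective (A := C) (o : FractionRing C)
    refine ⟨a, b, nonZeroDivisors.ne_zero hb, Subtype.ext ?_⟩
    have : algebraMap C (FractionRing C) b ≠ 0 :=
      IsFractionRing.to_map_ne_zero_of_mem_nonZeroDivisors hb
    change algebraMap C (FractionRing C) b * (o : FractionRing C) = algebraMap C (FractionRing C) a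
    rw [← hab]; field_simp
  have hidx {c : C} (hc : c ≠ 0) := idx_finite_birational (k := k) hC hO hc
  have hne {c : C} (hc : c ≠ 0) : algebraMap C O c ≠ 0 := (map_ne_zero_iff _ hinj).2 hc
  constructor
  · intro n a b hn ha hb hdvd
    rw [← (hidx ha).2, ← (hidx hb).2] at hdvd
    obtain ⟨z₁, z₂, hz, h⟩ := exists_mul_pow_eq_of_dvd_idx hres (hpow n hn) (hne ha) (hne hb) hdvd
    obtain ⟨c₁, d₁, hd₁, h₁⟩ := hO z₁
    obtain ⟨c₂, d₂, hd₂, h₂⟩ := hO z₂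
    refine ⟨c₁ * d₂, c₂ * d₁, mul_ne_zero (fun h0 ↦ ?_) hd₁, hinj ?_⟩
    · rw [h0, map_zero] at h₂
      exact mul_ne_zero (hne hd₂) hz h₂
    · simp only [map_mul, map_pow, ← h₁, ← h₂]
      linear_combination (algebraMap C O d₁ * algebraMap C O d₂) ^ n * h
  · obtain ⟨ϖ, hϖ⟩ := IsDiscreteValuationRing.exists_irreducible O
    obtain ⟨a, b, hb, hab⟩ := hO ϖ
    have ha : a ≠ 0 := by
      rintro rfl
      rw [map_zero] at hab
      exact mul_ne_zero (hne hb) hϖ.ne_zero hab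
    refine ⟨a, b, ha, hb, ?_⟩
    obtain ⟨h4, h5⟩ := hasIdx_irreducible hres hϖ
    rw [← (hidx ha).2, ← (hidx hb).2, ← hab, idx_mul (hidx hb).1 h4, h5]
    ring

end Curve

section Completion

open IsDedekindDomain HeightOneSpectrum Filter Topology WithZero

variable {R : Type*} [CommRing R] [IsDedekindDomain R] {K : Type*} [Field K] [Algebra R K]
  [IsFractionRing R K] (v : HeightOneSpectrum R)

lemma valued_algebraMap_field (k : K) :
    Valued.v (algebraMap K (v.adicCompletion K) k) = v.valuation K k :=
  valuedAdicCompletion_eq_valuation' v k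

lemma valued_algebraMap (r : R) :
    Valued.v (algebraMap R (v.adicCompletion K) r) = v.intValuation r := by
  rw [← v.valuation_of_algebraMap (K := K), ← valuedAdicCompletion_eq_valuation]

lemma valued_lt_mem_nhds {ε : ℤᵐ⁰} (hε : ε ≠ 0) (g : v.adicCompletion K) :
    {x : v.adicCompletion K | Valued.v (x - g) < ε} ∈ 𝓝 g := by
  obtain ⟨k, rfl⟩ := v.valuation_surjective K ε
  rw [← valued_algebraMap_field] at hε ⊢
  rw [Valued.mem_nhds]
  refine ⟨Units.mk0 (Valued.v.restrict (algebraMap K (v.adicCompletion K) k)) fun h ↦ hε ?_,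
    fun y hy ↦ ?_⟩
  · rw [← Valuation.embedding_restrict, h, map_zero]
  · simpa [Valuation.restrict_lt_iff] using hy

lemma exists_valued_algebraMap_sub_lt {ε : ℤᵐ⁰} (hε : ε ≠ 0) {g : v.adicCompletion K}
    (hg : Valued.v g ≤ 1) : ∃ r : R, Valued.v (algebraMap R (v.adicCompletion K) r - g) < ε := by
  have hε' : min ε 1 ≠ 0 := by
    rcases min_choice ε 1 with h | h <;> rw [h]
    exacts [hε, one_ne_zero]
  obtain ⟨k, hk⟩ := (denseRange_algebraMap K v).exists_mem_open isOpen_interior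
    ⟨g, mem_interior_iff_mem_nhds.2 (valued_lt_mem_nhds v hε' g)⟩
  have hk := interior_subset hk
  simp only [Set.mem_ofPred_eq, lt_min_iff] at hk
  have hk1 : v.valuation K k ≤ 1 := by
    rw [← valued_algebraMap_field]
    have := Valuation.map_add_le Valued.v hk.2.le hg
    rwa [sub_add_cancel] at this
  obtain ⟨r, hr⟩ := exists_valuation_sub_lt_of_integer v hk1 (Units.mk0 ε hε)
  refine ⟨r, ?_⟩
  rw [← valued_algebraMap_field] at hr
  have h2 := Valuation.map_add_lt Valued.v hr hk.1
  rwa [map_sub, sub_add_sub_cancel, ← IsScalarTower.algebraMap_apply] at h2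

lemma exists_valued_lt_subset {s : Set (v.adicCompletion K)} (hs : s ∈ 𝓝 0) :
    ∃ ε : ℤᵐ⁰, ε ≠ 0 ∧ {x : v.adicCompletion K | Valued.v x < ε} ⊆ s := by
  obtain ⟨γ, hγ⟩ := Valued.mem_nhds.1 hs
  refine ⟨_, (map_ne_zero MonoidWithZeroHom.ValueGroup₀.embedding).2 γ.ne_zero, fun x hx ↦ hγ ?_⟩
  simpa only [sub_zero, Set.mem_ofPred_eq, Valuation.restrict_lt_iff_lt_embedding] using hx

lemma nonarchimedeanAddGroup_adicCompletion :
    NonarchimedeanAddGroup (v.adicCompletion K) where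
  is_nonarchimedean U hU := by
    obtain ⟨ε, hε, hs⟩ := exists_valued_lt_subset v hU
    refine ⟨⟨Valued.v.ltAddSubgroup (Units.mk0 ε hε), ?_⟩, hs⟩
    refine AddSubgroup.isOpen_of_mem_nhds _ (g := 0) ?_
    simpa using! valued_lt_mem_nhds v hε 0

lemma tendsto_algebraMap_zero {u : ℕ → R} (hu : ∀ j, u j ∈ v.asIdeal ^ j) :
    Tendsto (fun j ↦ algebraMap R (v.adicCompletion K) (u j)) atTop (𝓝 0) := by
  intro s hs
  obtain ⟨ε, hε, hs⟩ := exists_valued_lt_subset v hs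
  obtain ⟨j, hj⟩ : ∃ j : ℕ, exp (-(j : ℤ)) < ε := by
    refine ⟨(1 - log ε).toNat, ?_⟩
    rw [← lt_log_iff_exp_lt hε]
    omega
  refine mem_atTop_sets.2 ⟨j, fun m hm ↦ hs ?_⟩
  refine lt_of_le_of_lt ?_ hj
  rw [valued_algebraMap, intValuation_le_pow_iff_mem]
  exact Ideal.pow_le_pow_right hm (hu m)

lemma isPowerAt_of_pow_mul_eq {n : ℕ} {c₁ c₂ : R} (h₁ : c₁ ∉ v.asIdeal) (h₂ : c₂ ∉ v.asIdeal)
    (hn : n ≠ 0) {g : v.adicCompletion K}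
    (hg : g ^ n * algebraMap R (v.adicCompletion K) c₂ = algebraMap R (v.adicCompletion K) c₁) :
    IsPowerAt n c₁ c₂ v := by
  intro j
  have h1 : Valued.v g = 1 := by
    have := congrArg Valued.v hg
    rw [map_mul, map_pow, valued_algebraMap, valued_algebraMap,
      v.intValuation_eq_one_iff.2 h₁, v.intValuation_eq_one_iff.2 h₂, mul_one] at this
    exact (pow_eq_one_iff_of_nonneg zero_le hn).1 this
  obtain ⟨r, hr⟩ := exists_valued_algebraMap_sub_lt v (ε := exp (-(j : ℤ))) exp_ne_zero h1.le
  refine ⟨r, ?_⟩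
  rw [← intValuation_le_pow_iff_mem, ← valued_algebraMap (K := K)]
  have hr1 : Valued.v (algebraMap R (v.adicCompletion K) r) ≤ 1 := by
    rw [valued_algebraMap]; exact v.intValuation_le_one r
  have hc1 : Valued.v (algebraMap R (v.adicCompletion K) c₂) ≤ 1 := by
    rw [valued_algebraMap]; exact v.intValuation_le_one c₂
  obtain ⟨q, hq⟩ := sub_dvd_pow_sub_pow 
    (⟨algebraMap R (v.adicCompletion K) r, (Valuation.mem_integer_iff _ _).2 hr1⟩ : Valued.v.integer)
    ⟨g, (Valuation.mem_integer_iff _ _).2 h1.le⟩ n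
  have hq' := congrArg Subtype.val hq
  simp only [Subring.coe_mul, AddSubgroupClass.coe_sub, SubmonoidClass.coe_pow] at hq'
  have : algebraMap R (v.adicCompletion K) (c₁ - r ^ n * c₂) =
      - ((algebraMap R (v.adicCompletion K) r - g) * q * algebraMap R (v.adicCompletion K) c₂) := by
    rw [← hq', map_sub, map_mul, map_pow, ← hg]; ring
  rw [this, Valuation.map_neg, map_mul, map_mul]
  exact (mul_le_of_le_one_right' hc1).trans ((mul_le_of_le_one_right' q.2).trans hr.le)

lemma exists_pow_mul_eq_of_sub_mem {n : ℕ} {c₁ c₂ z : R} (h₁ : c₁ ∉ v.asIdeal)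
    (h₂ : c₂ ∉ v.asIdeal) (hn : (n : R) ∉ v.asIdeal) (hz : c₁ - z ^ n * c₂ ∈ v.asIdeal) :
    ∃ g : v.adicCompletion K,
      g ^ n * algebraMap R (v.adicCompletion K) c₂ = algebraMap R (v.adicCompletion K) c₁ := by
  have hn0 : n ≠ 0 := by rintro rfl; simp at hn
  have hprime := v.isPrime
  have hmax := v.isMaximal
  have step (j : ℕ) (z : {z : R // c₁ - z ^ n * c₂ ∈ v.asIdeal ^ (j + 1)}) :
      ∃ z' : {z : R // c₁ - z ^ n * c₂ ∈ v.asIdeal ^ (j + 1 + 1)},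
        (z' : R) - z ∈ v.asIdeal ^ j := by
    obtain ⟨z, hz⟩ := z
    have hz0 : z ∉ v.asIdeal := fun h ↦ h₁ <| by
      have := Ideal.pow_le_self (Nat.succ_ne_zero j) hz
      rwa [Submodule.sub_mem_iff_left] at this
      exact Ideal.mul_mem_right _ _ (Ideal.pow_mem_of_mem _ h _ (Nat.pos_of_ne_zero hn0))
    have hd : n * z ^ (n - 1) * c₂ ∉ v.asIdeal := by
      rw [hprime.mul_mem_iff_mem_or_mem, hprime.mul_mem_iff_mem_or_mem]
      rintro ((h | h) | h)
      exacts [hn h, hz0 (hprime.mem_of_pow_mem _ h), h₂ h]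
    obtain ⟨e, he⟩ := hmax.exists_inv hd
    obtain ⟨i, hi, he⟩ := he
    obtain ⟨k, hk⟩ := Polynomial.powAddExpansion z (e * (c₁ - z ^ n * c₂)) n
    refine ⟨⟨z + e * (c₁ - z ^ n * c₂), ?_⟩, ?_⟩
    · have h3 : c₁ - (z + e * (c₁ - z ^ n * c₂)) ^ n * c₂ = (c₁ - z ^ n * c₂) * i
          - k * c₂ * e ^ 2 * (c₁ - z ^ n * c₂) ^ 2 := by
        rw [hk]
        linear_combination (c₁ - z ^ n * c₂) * (-he)
      rw [h3]
      refine sub_mem ?_ (Ideal.mul_mem_left _ _ ?_)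
      · rw [pow_succ v.asIdeal (j + 1)]; exact Ideal.mul_mem_mul hz hi
      · have := Ideal.pow_mem_pow hz 2
        rw [← pow_mul] at this
        exact Ideal.pow_le_pow_right (by omega) this
    · simp only [add_sub_cancel_left]
      exact Ideal.mul_mem_left _ _ (Ideal.pow_le_pow_right (Nat.le_succ j) hz)
  choose F hF using step
  let Z : (j : ℕ) → {z : R // c₁ - z ^ n * c₂ ∈ v.asIdeal ^ (j + 1)} :=
    fun j ↦ Nat.rec ⟨z, by simpa using hz⟩ F j
 
  have hZ (j : ℕ) : (Z (j + 1)).1 - (Z j).1 ∈ v.asIdeal ^ j := hF j (Z j)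
  have hc : CauchySeq fun j ↦ algebraMap R (v.adicCompletion K) (Z j).1 := by
    have := nonarchimedeanAddGroup_adicCompletion (K := K) v
    apply NonarchimedeanAddGroup.cauchySeq_of_tendsto_sub_nhds_zero
    simpa using tendsto_algebraMap_zero (K := K) v hZ
  obtain ⟨g, hg⟩ := cauchySeq_tendsto_of_complete hc
  refine ⟨g, ?_⟩
  have h4 := tendsto_algebraMap_zero (K := K) v
    (fun j ↦ Ideal.pow_le_pow_right (Nat.le_succ j) (Z j).2)
  simp only [map_sub, map_mul, map_pow] at h4
  have h5 := (hg.pow n).mul_const (algebraMap R (v.adicCompletion K) c₂) |>.const_sub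
    (algebraMap R (v.adicCompletion K) c₁)
  exact (sub_eq_zero.1 (tendsto_nhds_unique h5 h4)).symm

end Completion

section Surface

variable {k : Type*} [Field k]

/-- A noetherian domain that is regular along a prime element `x`, in the weak sense that all the
primes strictly containing `x` have finite-dimensional residue ring. -/
def IsSurfaceAlong (k : Type*) {B : Type*} [Field k] [CommRing B] [Algebra k B] (x : B) : Prop :=
  (Ideal.span {x}).IsPrime ∧
    ∀ P : Ideal B, P.IsPrime → Ideal.span {x} < P → Module.Finite k (B ⧸ P)

lemma height_lt_of_chain {B : Type*} [CommRing B] [IsDomain B] [IsNoetherianRing B] {P Q : Ideal B}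
    (hP : P.IsPrime) (hQ : Q.IsPrime) (h0 : P ≠ ⊥) (h : P < Q) : 1 < Q.height := by
  have h1 := Ideal.height_strict_mono_of_isPrime_of_isPrime h
  have h2 := Ideal.height_strict_mono_of_isPrime_of_isPrime (bot_lt_iff_ne_bot.2 h0)
  rw [Ideal.height_bot, ← Order.one_le_iff_pos] at h2
  exact h2.trans_lt h1

theorem isSurfaceLike_of_finite {A B R : Type*} [CommRing B] [IsDomain B] [IsNoetherianRing B]
    [Algebra k B] [CommRing A] [IsDomain A] [Algebra k A] [Algebra B A] [IsScalarTower k B A]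
    [Module.Finite B A] [FaithfulSMul B A] [CommRing R] [IsDedekindDomain R] [Algebra A R] {x : B}
    [IsLocalization.Away (algebraMap B A x) R] (hx : x ≠ 0) (hB : IsSurfaceAlong k x) :
    IsSurfaceLike k (algebraMap B A x) := by
  intro P Q hP hQ h0 h
  have h1 : algebraMap B A x ∈ Q := by
    by_contra hxQ
    have hd (I : Ideal A) (hI : I.IsPrime) (hxI : algebraMap B A x ∉ I) : 
        Disjoint (Submonoid.powers (algebraMap B A x) : Set A) I := by
      rw [Set.disjoint_left]
      rintro _ ⟨n, rfl⟩ h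
      exact hxI (hI.mem_of_pow_mem _ h)
    have hdQ := hd Q hQ hxQ
    have hdP := hd P hP fun h' ↦ hxQ (h.le h')
    have hP' := IsLocalization.isPrime_of_isPrime_disjoint (.powers (algebraMap B A x)) R P hP hdP
    have hQ' := IsLocalization.isPrime_of_isPrime_disjoint (.powers (algebraMap B A x)) R Q hQ hdQ
    have hcP := IsLocalization.under_map_of_isPrime_disjoint (.powers (algebraMap B A x)) R hP hdP
    have hcQ := IsLocalization.under_map_of_isPrime_disjoint (.powers (algebraMap B A x)) R hQ hdQ
    have hbot : P.map (algebraMap A R) ≠ ⊥ := by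
      intro hb
      rw [Ideal.map_eq_bot_iff_of_injective] at hb
      · exact h0 hb
      · apply IsLocalization.injective R (M := .powers (algebraMap B A x))
        exact powers_le_nonZeroDivisors_of_noZeroDivisors (by simpa using hx)
    have hm := hP'.isMaximal hbot
    have := hm.eq_of_le hQ'.ne_top (Ideal.map_mono h.le)
    rw [← hcP, ← hcQ, this] at h
    exact h.false
  refine ⟨h1, ?_⟩
  have hlt : P.under B < Q.under B := Ideal.comap_lt_comap_of_integral_mem_sdiff
    h.le (Set.exists_of_ssubset h).choose_spec (Algebra.IsIntegral.isIntegral _)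
  have hne : P.under B ≠ ⊥ := fun hb ↦ h0 (Ideal.eq_bot_of_comap_eq_bot hb)
  have hfin : Module.Finite k (B ⧸ Q.under B) := by
    refine hB.2 _ inferInstance (lt_of_le_of_ne ?_ fun heq ↦ ?_)
    · rwa [Ideal.span_singleton_le_iff_mem]
    · have h2 := height_lt_of_chain (Ideal.IsPrime.under B P) (Ideal.IsPrime.under B Q) hne hlt
      have : (Ideal.span {x}).height ≤ 1 := by
        have := hB.1
        apply Ideal.height_le_one_of_isPrincipal_of_mem_minimalPrimes (Ideal.span {x})
        rw [Ideal.minimalPrimes_eq_subsingleton_self]; rfl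
      rw [heq] at this
      exact absurd h2 this.not_gt
  have : Module.Finite (B ⧸ Q.under B) (A ⧸ Q) := inferInstance
  exact Module.Finite.trans (B ⧸ Q.under B) (A ⧸ Q)

lemma algebraMap_mem_of_isMaximal {A B : Type*} [CommRing B] [IsLocalRing B]
    [CommRing A] [Algebra B A] [Algebra.IsIntegral B A] {x : B} (hx : ¬ IsUnit x) (M : Ideal A)
    [M.IsMaximal] : algebraMap B A x ∈ M := by
  have := Ideal.isMaximal_comap_of_isIntegral_of_isMaximal (R := B) M
  rw [← Ideal.mem_comap, IsLocalRing.eq_maximalIdeal this]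
  exact hx

lemma IsSurfaceAlong.of_algEquiv {B T : Type*} [CommRing B] [Algebra k B] [CommRing T]
    [Algebra k T] (e : B ≃ₐ[k] T) {x : B} (h : IsSurfaceAlong k (e x)) : IsSurfaceAlong k x := by
  have hx : Ideal.span {x} = (Ideal.span {e x}).comap e := by
    ext b
    rw [Ideal.mem_comap, Ideal.mem_span_singleton, Ideal.mem_span_singleton]
    exact (map_dvd_iff e).symm
  refine ⟨hx ▸ h.1.comap e, fun P hP hlt ↦ ?_⟩
  have hQ : (P.comap e.symm).IsPrime := hP.comap e.symm
  have hPQ : P = (P.comap e.symm).comap e := by ext; simp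
  have := h.2 _ hQ (lt_of_le_of_ne ?_ fun heq ↦ ?_)
  · exact Module.Finite.equiv
      (Ideal.quotientEquivAlg P (P.comap e.symm) e (Ideal.map_comap_of_equiv e.toRingEquiv).symm).symm.toLinearEquiv
  · rw [Ideal.span_singleton_le_iff_mem, Ideal.mem_comap]
    simpa using hlt.le (Ideal.mem_span_singleton_self x)
  · rw [hx, heq, ← hPQ] at hlt
    exact hlt.false

lemma isSurfaceAlong_powerSeries_X {S : Type*} [CommRing S] [IsDomain S] [IsLocalRing S]
    [IsPrincipalIdealRing S] [Algebra k S]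
    (hS : ∀ s : S, ∃ c : k, s - algebraMap k S c ∈ IsLocalRing.maximalIdeal S) :
    IsSurfaceAlong k (PowerSeries.X : PowerSeries S) := by
  refine ⟨(Ideal.span_singleton_prime PowerSeries.X_ne_zero).2 PowerSeries.X_prime,
    fun P hP hlt ↦ ?_⟩
  have hX : PowerSeries.X ∈ P := hlt.le (Ideal.mem_span_singleton_self _)
  have hC (f : PowerSeries S) : f - PowerSeries.C f.constantCoeff ∈ P := by
    refine P.mem_of_dvd ?_ hX
    rw [PowerSeries.X_dvd_iff]; simp
  have hne : P.comap (PowerSeries.C (R := S)) ≠ ⊥ := by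
    obtain ⟨f, hf, hfX⟩ := Set.exists_of_ssubset hlt
    intro hb
    have : f.constantCoeff ∈ P.comap (PowerSeries.C (R := S)) := by
      rw [Ideal.mem_comap]
      have := P.sub_mem hf (hC f)
      rwa [sub_sub_cancel] at this
    rw [hb, Ideal.mem_bot, ← PowerSeries.X_dvd_iff] at this
    exact hfX (Ideal.mem_span_singleton.2 this)
  have hm := IsLocalRing.eq_maximalIdeal ((hP.comap (PowerSeries.C (R := S))).isMaximal hne)
  refine Module.Finite.of_surjective (Algebra.linearMap k _) fun y ↦ ?_
  obtain ⟨f, rfl⟩ := Ideal.Quotient.mk_surjective y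
  obtain ⟨c, hc⟩ := hS f.constantCoeff
  refine ⟨c, ?_⟩
  rw [← hm, Ideal.mem_comap] at hc
  have := P.add_mem (hC f) hc
  rw [map_sub, sub_add_sub_cancel] at this
  rw [Algebra.linearMap_apply, IsScalarTower.algebraMap_apply k (PowerSeries S),
    PowerSeries.algebraMap_apply]
  exact (Ideal.Quotient.eq.2 this).symm

end Surface

section BivariatePowerSeries

open MvPowerSeries

lemma isDomain_mvPowerSeries {σ : Type*} {k : Type*} [Field k] : IsDomain (MvPowerSeries σ k) :=
  NoZeroDivisors.to_isDomain _

lemma isPrincipalIdealRing_mvPowerSeries {k : Type*} [Field k] :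
    IsPrincipalIdealRing (MvPowerSeries (Fin 1) k) := by
  let e : PowerSeries k ≃+* MvPowerSeries (Fin 1) k :=
    (renameEquiv k (Equiv.ofUnique Unit (Fin 1))).toRingEquiv
  exact IsPrincipalIdealRing.of_surjective (e : PowerSeries k →+* _) e.surjective

lemma isSurfaceAlong_mvPowerSeries_X {k : Type*} [Field k] :
    IsSurfaceAlong k (X 0 : MvPowerSeries (Fin 2) k) := by
  have := isDomain_mvPowerSeries (σ := Fin 1) (k := k)
  have := isPrincipalIdealRing_mvPowerSeries (k := k)
  apply IsSurfaceAlong.of_algEquiv (finSuccEquiv k 1)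
  rw [finSuccEquiv_X_zero]
  refine isSurfaceAlong_powerSeries_X fun s ↦ ⟨constantCoeff s, ?_⟩
  rw [IsLocalRing.mem_maximalIdeal, mem_nonunits_iff, isUnit_iff_constantCoeff]
  simp [MvPowerSeries.algebraMap_apply]

lemma isIntegrallyClosed_mvPowerSeries {k : Type*} [Field k] :
    IsIntegrallyClosed (MvPowerSeries (Fin 2) k) := by
  have := isDomain_mvPowerSeries (σ := Fin 1) (k := k)
  have := isDomain_mvPowerSeries (σ := Fin 2) (k := k)
  have := isPrincipalIdealRing_mvPowerSeries (k := k)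
  have : UniqueFactorizationMonoid (MvPowerSeries (Fin 2) k) :=
    (finSuccEquiv k 1).symm.toMulEquiv.uniqueFactorizationMonoid inferInstance
  infer_instance

lemma exists_algHom_mvPowerSeries {k : Type*} [Field k] :
    ∃ φ : PowerSeries k →ₐ[k] MvPowerSeries (Fin 2) k, φ PowerSeries.X = X 0 := by
  refine ⟨(finSuccEquiv k 1).symm.toAlgHom.comp
    (PowerSeries.mapAlgHom (Algebra.ofId k (MvPowerSeries (Fin 1) k))), ?_⟩
  rw [AlgHom.comp_apply, PowerSeries.mapAlgHom_apply, PowerSeries.map_X]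
  exact (AlgEquiv.symm_apply_eq _).2 finSuccEquiv_X_zero.symm

end BivariatePowerSeries

section LocalGlobal

open IsDedekindDomain HeightOneSpectrum WithZero

section Lift

variable {A R : Type*} [CommRing A] [IsDomain A] [CommRing R] [IsDedekindDomain R] [Algebra A R]
  (x : A) [IsLocalization.Away x R] (v : HeightOneSpectrum R)

include x

omit [IsDomain A] [IsDedekindDomain R] in
lemma algebraMap_away_notMem : algebraMap A R x ∉ v.asIdeal := fun h ↦
  v.isPrime.ne_top (Ideal.eq_top_of_isUnit_mem _ h (IsLocalization.Away.algebraMap_isUnit x))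

omit [IsDedekindDomain R] in
lemma algebraMap_away_injective (hx : x ≠ 0) : Function.Injective (algebraMap A R) :=
  IsLocalization.injective R (M := .powers x)
    (powers_le_nonZeroDivisors_of_noZeroDivisors hx)

omit [IsDomain A] in
lemma exists_mem_under_of_not_le {w : HeightOneSpectrum R} (h : w ≠ v) :
    ∃ s : A, algebraMap A R s ∉ v.asIdeal ∧ algebraMap A R s ∈ w.asIdeal := by
  obtain ⟨r, hr, hrv⟩ := Set.not_subset.1 fun hle : (w.asIdeal : Set R) ⊆ v.asIdeal ↦
    h (HeightOneSpectrum.ext (w.isMaximal.eq_of_le v.isPrime.ne_top hle))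
  obtain ⟨m, s, hs⟩ := IsLocalization.Away.surj x r
  refine ⟨s, ?_, hs ▸ Ideal.mul_mem_right _ _ hr⟩
  rw [← hs, v.isPrime.mul_mem_iff_mem_or_mem]
  rintro (h | h)
  exacts [hrv h, algebraMap_away_notMem x v (v.isPrime.mem_of_pow_mem _ h)]

omit [IsDomain A] in
lemma exists_mem_under_of_finite {T : Set (HeightOneSpectrum R)} (hT : T.Finite) :
    ∃ s : A, algebraMap A R s ∉ v.asIdeal ∧ ∀ w ∈ T, w ≠ v → algebraMap A R s ∈ w.asIdeal := by
  induction T, hT using Set.Finite.induction_on with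
  | empty => exact ⟨1, by simpa using v.asIdeal.ne_top_iff_one.1 v.isPrime.ne_top, by simp⟩
  | @insert w T _ _ ih =>
    obtain ⟨s, hs, h⟩ := ih
    by_cases hw : w = v
    · refine ⟨s, hs, ?_⟩
      rintro w' (rfl | h') hne
      exacts [absurd hw hne, h w' h' hne]
    · obtain ⟨t, ht, htw⟩ := exists_mem_under_of_not_le x v hw
      refine ⟨s * t, ?_, ?_⟩
      · rw [map_mul, v.isPrime.mul_mem_iff_mem_or_mem]
        tauto
      · rintro w' (rfl | h') hne <;> rw [map_mul]
        exacts [Ideal.mul_mem_left _ _ htw, Ideal.mul_mem_right _ _ (h w' h' hne)]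

omit [IsDomain A] in
lemma exists_uniformizer : ∃ π : A, algebraMap A R π ∈ v.asIdeal ∧
    algebraMap A R π ∉ v.asIdeal ^ 2 := by
  obtain ⟨p, hp⟩ := v.intValuation_exists_uniformizer
  obtain ⟨m, π, hπ⟩ := IsLocalization.Away.surj x p
  have h : v.intValuation (algebraMap A R π) = exp (-1) := by
    rw [← hπ, map_mul, map_pow, v.intValuation_eq_one_iff.2 (algebraMap_away_notMem x v), hp]
    simp
  refine ⟨π, ?_, ?_⟩
  · rw [← pow_one v.asIdeal, ← intValuation_le_pow_iff_mem, h]; simp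
  · rw [← intValuation_le_pow_iff_mem, h, exp_le_exp]; norm_num

lemma exists_dvd_mul_of_mem (hx : x ≠ 0) {π : A} (hπ : algebraMap A R π ∈ v.asIdeal)
    (hπ2 : algebraMap A R π ∉ v.asIdeal ^ 2) {b : A} (hb : algebraMap A R b ∈ v.asIdeal) :
    ∃ c : A, algebraMap A R c ∉ v.asIdeal ∧ π ∣ c * b := by
  obtain ⟨J, hJ⟩ := Ideal.dvd_span_singleton.2 hπ
  have hJv : ¬ J ≤ v.asIdeal := fun h ↦ hπ2 <| by
    have : algebraMap A R π ∈ v.asIdeal * J := hJ ▸ Ideal.mem_span_singleton_self _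
    rw [pow_two]
    exact Ideal.mul_mono_right h this
  obtain ⟨j, hj, hjv⟩ := Set.not_subset.1 hJv
  have h1 : j * algebraMap A R b ∈ Ideal.span {algebraMap A R π} := by
    rw [hJ, mul_comm j]; exact Ideal.mul_mem_mul hb hj
  obtain ⟨r, hr⟩ := Ideal.mem_span_singleton.1 h1
  obtain ⟨m, c, hc⟩ := IsLocalization.Away.surj x j
  obtain ⟨l, a, ha⟩ := IsLocalization.Away.surj x r
  have hx' := algebraMap_away_notMem x v
  refine ⟨c * x ^ l, ?_, a * x ^ m, ?_⟩
  · rw [map_mul, ← hc, map_pow, v.isPrime.mul_mem_iff_mem_or_mem,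
      v.isPrime.mul_mem_iff_mem_or_mem]
    rintro ((h | h) | h)
    exacts [hjv h, hx' (v.isPrime.mem_of_pow_mem _ h), hx' (v.isPrime.mem_of_pow_mem _ h)]
  · apply algebraMap_away_injective (R := R) x hx
    simp only [map_mul, map_pow, ← hc, ← ha]
    linear_combination algebraMap A R x ^ m * algebraMap A R x ^ l * hr

lemma exists_forall_dvd_mul [IsNoetherianRing A] (hx : x ≠ 0) {π : A}
    (hπ : algebraMap A R π ∈ v.asIdeal) (hπ2 : algebraMap A R π ∉ v.asIdeal ^ 2) :
    ∃ c : A, algebraMap A R c ∉ v.asIdeal ∧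
      ∀ b, algebraMap A R b ∈ v.asIdeal → π ∣ c * b := by
  suffices H : ∀ I : Ideal A, I ≤ v.asIdeal.comap (algebraMap A R) →
      ∃ c : A, algebraMap A R c ∉ v.asIdeal ∧ ∀ b ∈ I, π ∣ c * b by
    simpa using H _ le_rfl
  intro I hI
  induction I, (isNoetherianRing_iff_ideal_fg A).1 ‹_› I using Submodule.fg_induction with
  | singleton b =>
    obtain ⟨c, hc, h⟩ := exists_dvd_mul_of_mem x v hx hπ hπ2 (b := b)
      (hI (Submodule.mem_span_singleton_self b))
    refine ⟨c, hc, fun b' hb' ↦ ?_⟩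
    obtain ⟨u, rfl⟩ := Submodule.mem_span_singleton.1 hb'
    rw [smul_eq_mul, mul_left_comm]
    exact h.mul_left _
  | sup I₁ I₂ _ _ h₁ h₂ =>
    obtain ⟨c₁, hc₁, h₁⟩ := h₁ (le_sup_left.trans hI)
    obtain ⟨c₂, hc₂, h₂⟩ := h₂ (le_sup_right.trans hI)
    refine ⟨c₁ * c₂, ?_, fun b hb ↦ ?_⟩
    · rw [map_mul, v.isPrime.mul_mem_iff_mem_or_mem]; tauto
    · obtain ⟨b₁, hb₁, b₂, hb₂, rfl⟩ := Submodule.mem_sup.1 hb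
      have : c₁ * c₂ * (b₁ + b₂) = c₂ * (c₁ * b₁) + c₁ * (c₂ * b₂) := by ring
      rw [this]
      exact ((h₁ _ hb₁).mul_left _).add ((h₂ _ hb₂).mul_left _)

lemma exists_mul_eq_pow_mul [IsNoetherianRing A] (hx : x ≠ 0) {π : A}
    (hπ : algebraMap A R π ∈ v.asIdeal) (hπ2 : algebraMap A R π ∉ v.asIdeal ^ 2) {a : A}
    (ha : a ≠ 0) : ∃ (t : ℕ) (d₁ d₂ : A), algebraMap A R d₁ ∉ v.asIdeal ∧
      algebraMap A R d₂ ∉ v.asIdeal ∧ d₁ * a = π ^ t * d₂ := by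
  obtain ⟨c, hc, hcπ⟩ := exists_forall_dvd_mul x v hx hπ hπ2
  have ha' : algebraMap A R a ≠ 0 :=
    (map_ne_zero_iff _ (algebraMap_away_injective x hx)).2 ha
  obtain ⟨m, hm⟩ : ∃ m : ℕ, algebraMap A R a ∉ v.asIdeal ^ m := by
    by_contra! h
    have := Ideal.iInf_pow_eq_bot_of_isDomain v.asIdeal v.isPrime.ne_top
    exact ha' (by rw [← Ideal.mem_bot, ← this]; simpa using h)
  induction m generalizing a with
  | zero => simp at hm
  | succ m ih =>
    by_cases hav : algebraMap A R a ∈ v.asIdeal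
    · obtain ⟨b, hb⟩ := hcπ a hav
      have hc0 : c ≠ 0 := by rintro rfl; simp at hc
      have hb0 : b ≠ 0 := by
        rintro rfl
        rw [mul_zero] at hb
        exact mul_ne_zero hc0 ha hb
      obtain ⟨t, d₁, d₂, h₁, h₂, h⟩ := ih hb0
        ((map_ne_zero_iff _ (algebraMap_away_injective x hx)).2 hb0) fun hbm ↦ hm <| by
          have : algebraMap A R (c * a) ∈ v.asIdeal ^ (m + 1) := by
            rw [hb, map_mul, pow_succ']; exact Ideal.mul_mem_mul hπ hbm
          rw [map_mul] at this
          exact (v.isPrime.mul_mem_pow _ this).resolve_left hc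
      refine ⟨t + 1, d₁ * c, d₂, ?_, h₂, ?_⟩
      · rw [map_mul, v.isPrime.mul_mem_iff_mem_or_mem]; tauto
      · rw [mul_assoc, hb, pow_succ]; linear_combination π * h
    · exact ⟨0, 1, a, by simpa using v.asIdeal.ne_top_iff_one.1 v.isPrime.ne_top, hav, by simp⟩

variable {K : Type*} [Field K] [Algebra R K] [IsFractionRing R K]

lemma exists_mul_eq_of_away (hx : x ≠ 0) {f : K} (hf : f ≠ 0) : ∃ a b : A, a ≠ 0 ∧ b ≠ 0 ∧
    f * algebraMap R K (algebraMap A R b) = algebraMap R K (algebraMap A R a) := by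
  have hinj : Function.Injective fun a : A ↦ algebraMap R K (algebraMap A R a) :=
    (IsFractionRing.injective R K).comp (algebraMap_away_injective x hx)
  obtain ⟨r, s, hs, rfl⟩ := IsFractionRing.div_surjective (A := R) f
  obtain ⟨m, a, ha⟩ := IsLocalization.Away.surj x r
  obtain ⟨l, b, hb⟩ := IsLocalization.Away.surj x s
  have hs0 : algebraMap R K s ≠ 0 := by
    simpa using nonZeroDivisors.ne_zero hs
  have hb0 : b * x ^ m ≠ 0 := by
    refine mul_ne_zero ?_ (pow_ne_zero _ hx)
    rintro rfl
    rw [map_zero, ← map_pow] at hb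
    rcases mul_eq_zero.1 hb with h | h
    · simp [h] at hs0
    · rw [map_eq_zero_iff _ (algebraMap_away_injective x hx)] at h
      exact pow_ne_zero _ hx h
  have key : algebraMap R K r / algebraMap R K s * algebraMap R K (algebraMap A R (b * x ^ m))
      = algebraMap R K (algebraMap A R (a * x ^ l)) := by
    simp only [map_mul, ← ha, ← hb, map_pow]
    field_simp
  refine ⟨a * x ^ l, b * x ^ m, ?_, hb0, key⟩
  rintro h0
  rw [h0, map_zero, map_zero] at key
  refine mul_ne_zero hf ?_ key
  rw [← map_zero (algebraMap R K), ← map_zero (algebraMap A R)]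
  exact fun h ↦ hb0 (hinj h)

lemma exists_mul_eq_pow_mul_field [IsNoetherianRing A] (hx : x ≠ 0) {π : A}
    (hπ : algebraMap A R π ∈ v.asIdeal) (hπ2 : algebraMap A R π ∉ v.asIdeal ^ 2) {f : K}
    (hf : f ≠ 0) : ∃ (t u : ℕ) (d₁ d₂ : A), algebraMap A R d₁ ∉ v.asIdeal ∧
      algebraMap A R d₂ ∉ v.asIdeal ∧
      f * algebraMap R K (algebraMap A R (π ^ u * d₁)) =
        algebraMap R K (algebraMap A R (π ^ t * d₂)) := by
  obtain ⟨a, b, ha, hb, h⟩ := exists_mul_eq_of_away (R := R) x hx hf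
  obtain ⟨t, d₁, d₂, h₁, h₂, h'⟩ := exists_mul_eq_pow_mul x v hx hπ hπ2 ha
  obtain ⟨u, e₁, e₂, hh₁, hh₂, h''⟩ := exists_mul_eq_pow_mul x v hx hπ hπ2 hb
  refine ⟨t, u, d₁ * e₂, d₂ * e₁, ?_, ?_, ?_⟩
  · rw [map_mul, v.isPrime.mul_mem_iff_mem_or_mem]; tauto
  · rw [map_mul, v.isPrime.mul_mem_iff_mem_or_mem]; tauto
  · have e1 : π ^ u * (d₁ * e₂) = d₁ * e₁ * b := by linear_combination - d₁ * h''
    have e2 : π ^ t * (d₂ * e₁) = d₁ * e₁ * a := by linear_combination - e₁ * h'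
    rw [e1, e2, map_mul, map_mul, map_mul _ _ a, map_mul _ _ (algebraMap A R a), ← h]
    ring

lemma exists_forall_isPowerAt (hx : x ≠ 0) {n : ℕ} (hn : n ≠ 0) {f : K}
    (hfin : {w : HeightOneSpectrum R |
      ¬ ∃ g : w.adicCompletion K, g ^ n = algebraMap K (w.adicCompletion K) f}.Finite) {a b : A}
    (ha : a ≠ 0) (hb : b ≠ 0)
    (h : f * algebraMap R K (algebraMap A R b) = algebraMap R K (algebraMap A R a)) :
    ∃ s : A, algebraMap A R s ∉ v.asIdeal ∧ ∀ w : HeightOneSpectrum R, w ≠ v →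
      algebraMap A R s ∉ w.asIdeal → IsPowerAt n (algebraMap A R a) (algebraMap A R b) w := by
  have hfin' (c : A) (hc : c ≠ 0) :
      {w : HeightOneSpectrum R | algebraMap A R c ∈ w.asIdeal}.Finite := by
    have := Ideal.finite_factors (I := Ideal.span {algebraMap A R c}) (by
      simpa using (map_ne_zero_iff _ (algebraMap_away_injective x hx)).2 hc)
    simpa only [Ideal.dvd_span_singleton] using this
  obtain ⟨s, hs, H⟩ := exists_mem_under_of_finite x v ((hfin.union (hfin' a ha)).union (hfin' b hb))
  refine ⟨s, hs, fun w hw hsw ↦ ?_⟩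
  have hwT : w ∉ _ := fun h ↦ hsw (H w h hw)
  simp only [Set.mem_union, Set.mem_ofPred_eq, not_or, not_not] at hwT
  obtain ⟨⟨⟨g, hg⟩, hwa⟩, hwb⟩ := hwT
  refine isPowerAt_of_pow_mul_eq (K := K) w hwa hwb hn (g := g) ?_
  rw [hg, IsScalarTower.algebraMap_apply R K, ← map_mul, h, ← IsScalarTower.algebraMap_apply]

end Lift

end LocalGlobal

section LocalGlobal

open IsDedekindDomain HeightOneSpectrum

open PowerSeries in
theorem exists_pow_eq_adicCompletion {k A R K : Type*} [Field k] [IsAlgClosed k] [CharZero k]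
    [CommRing A] [IsDomain A] [IsNoetherianRing A] [Algebra k A] [Algebra k⟦X⟧ A]
    [IsScalarTower k k⟦X⟧ A] [CommRing R] [IsDedekindDomain R] [Algebra A R] [Field K]
    [Algebra R K] [IsFractionRing R K] {x : A} [IsLocalization.Away x R]
    (hxX : algebraMap k⟦X⟧ A X = x) (hx : x ≠ 0) (hA : IsSurfaceLike k x)
    (hM : ∀ M : Ideal A, M.IsMaximal → x ∈ M) {n : ℕ} (hn : 1 ≤ n) {f : K} (hf : f ≠ 0)
    (hfin : {w : HeightOneSpectrum R |
      ¬ ∃ g : w.adicCompletion K, g ^ n = algebraMap K (w.adicCompletion K) f}.Finite)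
    (v : HeightOneSpectrum R) :
    ∃ g : v.adicCompletion K, g ^ n = algebraMap K (v.adicCompletion K) f := by
  rcases hn.eq_or_lt with rfl | hn2
  · exact ⟨_, pow_one _⟩
  replace hn2 : 2 ≤ n := hn2
  have hn0 : n ≠ 0 := by omega
  have hinj := algebraMap_away_injective (R := R) x hx
  have hne {a : A} (ha : algebraMap A R a ∉ v.asIdeal) : a ≠ 0 := by
    rintro rfl; simp at ha
  set 𝔭 : Ideal A := v.asIdeal.comap (algebraMap A R) with h𝔭def
  have h𝔭 (a : A) : a ∈ 𝔭 ↔ algebraMap A R a ∈ v.asIdeal := Iff.rfl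
  have h𝔭p : 𝔭.IsPrime := v.isPrime.comap _
  obtain ⟨π, hπ, hπ2⟩ := exists_uniformizer x v
  have hπ0 : π ≠ 0 := by rintro rfl; simp at hπ2
  have h0 : 𝔭 ≠ ⊥ := fun h ↦ hπ0 (by rw [← Ideal.mem_bot, ← h]; exact hπ)
  obtain ⟨c, hc, hcπ⟩ := exists_forall_dvd_mul x v hx hπ hπ2
  -- the curve defined by `𝔭`
  have hx𝔭 : x ∉ 𝔭 := algebraMap_away_notMem x v
  have hcurve := idx_curve (k := k) (C := A ⧸ 𝔭) (by
      rw [IsScalarTower.algebraMap_apply k⟦X⟧ A (A ⧸ 𝔭), hxX]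
      intro hu
      obtain ⟨M, hMm, hM𝔭⟩ := 𝔭.exists_le_maximal h𝔭p.ne_top
      have := hu.map (Ideal.Quotient.factor hM𝔭)
      rw [Ideal.Quotient.algebraMap_eq, Ideal.Quotient.factor_mk,
        Ideal.Quotient.eq_zero_iff_mem.2 (hM M hMm)] at this
      exact not_isUnit_zero this) (by
      rw [IsScalarTower.algebraMap_apply k⟦X⟧ A (A ⧸ 𝔭), hxX]
      exact fun h ↦ hx𝔭 (Ideal.Quotient.eq_zero_iff_mem.1 h)) (by
      intro P hP hPne
      set φ := (Ideal.Quotient.mkₐ k P).comp (Ideal.Quotient.mkₐ k 𝔭) with hφ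
      have hφs : Function.Surjective φ :=
        (Ideal.Quotient.mkₐ_surjective k P).comp (Ideal.Quotient.mkₐ_surjective k 𝔭)
      have hker : (RingHom.ker φ).IsPrime := RingHom.ker_isPrime _
      have hle : 𝔭 < RingHom.ker φ := by
        refine lt_of_le_of_ne (fun a ha ↦ ?_) fun heq ↦ hPne ?_
        · have : Ideal.Quotient.mk 𝔭 a = 0 := Ideal.Quotient.eq_zero_iff_mem.2 ha
          simp [hφ, RingHom.mem_ker, this]
        · refine eq_bot_iff.2 fun y hy ↦ ?_
          obtain ⟨a, rfl⟩ := Ideal.Quotient.mk_surjective y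
          rw [Ideal.mem_bot, Ideal.Quotient.eq_zero_iff_mem, heq]
          simpa [hφ, RingHom.mem_ker] using Ideal.Quotient.eq_zero_iff_mem.2 hy
      have := (hA 𝔭 _ h𝔭p hker h0 hle).2
      exact Module.Finite.equiv (Ideal.quotientKerAlgEquivOfSurjective hφs).toLinearEquiv)
  have hidx (a : A) : idx k (A ⧸ 𝔭) (Ideal.Quotient.mk 𝔭 a) = idx k (A ⧸ 𝔭) a :=
    congrArg LinearMap.coindex (lsmul_algebraMap a)
  -- it suffices to treat elements differing from `f` by `n`-th powers
  have hred {h h' : K} (y y' : K) (hy : y ≠ 0) (hh : h' * y ^ n = h * y' ^ n) (w : HeightOneSpectrum R)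
      (H : ∃ g : w.adicCompletion K, g ^ n = algebraMap K (w.adicCompletion K) h) :
      ∃ g : w.adicCompletion K, g ^ n = algebraMap K (w.adicCompletion K) h' := by
    obtain ⟨g, hg⟩ := H
    refine ⟨g * algebraMap K _ (y' / y), ?_⟩
    rw [mul_pow, hg, ← map_pow, ← map_mul]
    rw [div_pow, mul_div_assoc', ← hh, mul_div_cancel_right₀ _ (pow_ne_zero n hy)]
  obtain ⟨t, u, d₁, d₂, hd₁, hd₂, hf'⟩ := exists_mul_eq_pow_mul_field x v hx hπ hπ2 hf
  set ι : A →+* K := (algebraMap R K).comp (algebraMap A R) with hι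
  have hιinj : Function.Injective ι := (IsFractionRing.injective R K).comp hinj
  have hιπ : ι π ≠ 0 := (map_ne_zero_iff _ hιinj).2 hπ0
  replace hf' : f * ι (π ^ u * d₁) = ι (π ^ t * d₂) := hf'
  obtain ⟨m, rfl⟩ := Nat.exists_eq_add_of_le' hn
  have hpow : f * ι π ^ (u * (m + 1)) * ι d₁ = ι (π ^ (t + m * u) * d₂) := by
    simp only [map_mul, map_pow] at hf' ⊢
    rw [show u * (m + 1) = u + m * u by ring, pow_add, pow_add]
    linear_combination ι π ^ (m * u) * hf'
  -- the valuation of `f` is divisible by `n`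
  obtain ⟨l, hl⟩ : m + 1 ∣ t + m * u := by
    obtain ⟨s, hs, H⟩ := exists_forall_isPowerAt x v hx hn0 (f := f * ι π ^ (u * (m + 1)))
      (a := π ^ (t + m * u) * d₂) (b := d₁)
      (hfin.subset fun w hw hw' ↦ hw (hred 1 (ι π ^ u) one_ne_zero (by ring) w hw'))
      (mul_ne_zero (pow_ne_zero _ hπ0) (hne hd₂)) (hne hd₁) hpow
    have key := dvd_mul_idx_of_isPowerAt (k := k) hx hA hn0 v 𝔭 h𝔭 h0 hπ hc hcπ hd₁ hd₂ hs H
    obtain ⟨a, b, ha, hb, hab⟩ := hcurve.2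
    obtain ⟨a, rfl⟩ := Ideal.Quotient.mk_surjective a
    obtain ⟨b, rfl⟩ := Ideal.Quotient.mk_surjective b
    rw [hidx, hidx] at hab
    have h1 := dvd_sub (key a fun h ↦ ha (Ideal.Quotient.eq_zero_iff_mem.2 h))
      (key b fun h ↦ hb (Ideal.Quotient.eq_zero_iff_mem.2 h))
    rw [← mul_sub, hab, mul_one] at h1
    exact_mod_cast h1
  rw [hl] at hpow
  have hιd₁ : ι d₁ ≠ 0 := (map_ne_zero_iff _ hιinj).2 (hne hd₁)
  have hιd₂ : ι d₂ ≠ 0 := (map_ne_zero_iff _ hιinj).2 (hne hd₂)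
  have hh : ι d₂ / ι d₁ * ι d₁ = ι d₂ := by field_simp
  have hfh : f * (ι π ^ u) ^ (m + 1) = ι d₂ / ι d₁ * (ι π ^ l) ^ (m + 1) := by
    simp only [map_mul, map_pow] at hpow
    field_simp
    rw [← pow_mul, ← pow_mul, hpow]
    ring
  obtain ⟨s, hs, H⟩ := exists_forall_isPowerAt x v hx hn0 (f := ι d₂ / ι d₁)
      (a := d₂) (b := d₁)
      (hfin.subset fun w hw hw' ↦ hw (hred _ _ (pow_ne_zero _ hιπ) hfh.symm w hw'))
      (hne hd₂) (hne hd₁) hh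
  have key := dvd_idx_sub_of_isPowerAt (k := k) hx hA hn2 v 𝔭 h𝔭 h0 hπ hπ2 hd₂ hd₁ hs H
  rw [← hidx, ← hidx] at key
  obtain ⟨z₁, z₂, hz₂, hz⟩ := hcurve.1 _ _ _ hn0
    (fun h ↦ hd₂ ((h𝔭 _).1 (Ideal.Quotient.eq_zero_iff_mem.1 h)))
    (fun h ↦ hd₁ ((h𝔭 _).1 (Ideal.Quotient.eq_zero_iff_mem.1 h))) key
  obtain ⟨z₁, rfl⟩ := Ideal.Quotient.mk_surjective z₁
  obtain ⟨z₂, rfl⟩ := Ideal.Quotient.mk_surjective z₂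
  have hz₂v : algebraMap A R z₂ ∉ v.asIdeal := fun h ↦ hz₂ (Ideal.Quotient.eq_zero_iff_mem.2 h)
  have hzv : algebraMap A R (d₂ * z₂ ^ (m + 1) - z₁ ^ (m + 1) * d₁) ∈ v.asIdeal := by
    rw [← h𝔭, ← Ideal.Quotient.eq]
    simpa using hz
  obtain ⟨e, i, hi, he⟩ := v.isMaximal.exists_inv hz₂v
  have hnv : ((m + 1 : ℕ) : R) ∉ v.asIdeal := by
    have hu : IsUnit ((m + 1 : ℕ) : R) := by
      have := ((Nat.cast_ne_zero (R := k)).2 hn0).isUnit.map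
        ((algebraMap A R).comp (algebraMap k A))
      rwa [map_natCast] at this
    exact fun h ↦ v.isPrime.ne_top (Ideal.eq_top_of_isUnit_mem _ h hu)
  have hfinal : algebraMap A R d₂ - (e * algebraMap A R z₁) ^ (m + 1) * algebraMap A R d₁
      ∈ v.asIdeal := by
    obtain ⟨q, hq⟩ := sub_one_dvd_pow_sub_one (e * algebraMap A R z₂) (m + 1)
    have : algebraMap A R d₂ - (e * algebraMap A R z₁) ^ (m + 1) * algebraMap A R d₁ =
        e ^ (m + 1) * algebraMap A R (d₂ * z₂ ^ (m + 1) - z₁ ^ (m + 1) * d₁)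
          + i * (q * algebraMap A R d₂) := by
      simp only [map_sub, map_mul, map_pow]
      linear_combination (- algebraMap A R d₂) * hq - q * algebraMap A R d₂ * he
    rw [this]
    exact add_mem (Ideal.mul_mem_left _ _ hzv) (Ideal.mul_mem_right _ _ hi)
  obtain ⟨g, hg⟩ := exists_pow_mul_eq_of_sub_mem (K := K) v hd₂ hd₁ hnv hfinal
  refine hred _ _ (pow_ne_zero _ hιπ) hfh v ⟨g, ?_⟩
  rw [IsScalarTower.algebraMap_apply R K, IsScalarTower.algebraMap_apply R K] at hg
  rw [map_div₀, eq_div_iff]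
  · exact hg
  · exact (map_ne_zero _).2 hιd₁

end LocalGlobal

/-- Let `K` be a finite field extension of `ℂ((x,y))` (the fraction field of
`ℂ[[x,y]] = MvPowerSeries (Fin 2) ℂ`), let `A` be the integral closure of `ℂ[[x,y]]` in
`K`, and `R := A[1/x]`, a Dedekind domain with fraction field `K` whose nonzero prime
ideals (its height-one spectrum) are the places of `K`. Let `n ≥ 1` and `f ∈ K^×`. If
`f` is an `n`-th power in the `v`-adic completion `K_v` for all but finitely many places
`v`, then `f` is an `n`-th power in `K_v` for every place `v`. -/
theorem stmt_5
    (K : Type) [Field K]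
    [Algebra (MvPowerSeries (Fin 2) ℂ) K]
    [Algebra (FractionRing (MvPowerSeries (Fin 2) ℂ)) K]
    [IsScalarTower (MvPowerSeries (Fin 2) ℂ) (FractionRing (MvPowerSeries (Fin 2) ℂ)) K]
    [FiniteDimensional (FractionRing (MvPowerSeries (Fin 2) ℂ)) K]
    (R : Type) [CommRing R] [IsDedekindDomain R]
    [Algebra (integralClosure (MvPowerSeries (Fin 2) ℂ) K) R]
    [IsLocalization.Away
      (⟨algebraMap (MvPowerSeries (Fin 2) ℂ) K (MvPowerSeries.X 0),
        Subalgebra.algebraMap_mem _ _⟩ : integralClosure (MvPowerSeries (Fin 2) ℂ) K) R]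
    [Algebra R K] [IsFractionRing R K]
    [IsScalarTower (integralClosure (MvPowerSeries (Fin 2) ℂ) K) R K]
    (n : ℕ) (hn : 1 ≤ n) (f : K) (hf : f ≠ 0)
    (hfin : {v : IsDedekindDomain.HeightOneSpectrum R |
      ¬ ∃ g : v.adicCompletion K, g ^ n = algebraMap K (v.adicCompletion K) f}.Finite) :
    ∀ v : IsDedekindDomain.HeightOneSpectrum R,
      ∃ g : v.adicCompletion K, g ^ n = algebraMap K (v.adicCompletion K) f := by
  intro v
  have hBic := isIntegrallyClosed_mvPowerSeries (k := ℂ)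
  let A := integralClosure (MvPowerSeries (Fin 2) ℂ) K
  have hchar : CharZero (MvPowerSeries (Fin 2) ℂ) :=
    charZero_of_injective_algebraMap (algebraMap ℂ (MvPowerSeries (Fin 2) ℂ)).injective
  have hcharF : CharZero (FractionRing (MvPowerSeries (Fin 2) ℂ)) :=
    charZero_of_injective_algebraMap (IsFractionRing.injective (MvPowerSeries (Fin 2) ℂ) _)
  have hfinA : Module.Finite (MvPowerSeries (Fin 2) ℂ) A :=
    IsIntegralClosure.finite (MvPowerSeries (Fin 2) ℂ)
      (FractionRing (MvPowerSeries (Fin 2) ℂ)) K A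
  have hnoeth : IsNoetherianRing A := IsNoetherianRing.of_finite (MvPowerSeries (Fin 2) ℂ) A
  have hinjK : Function.Injective (algebraMap (MvPowerSeries (Fin 2) ℂ) K) := by
    rw [IsScalarTower.algebraMap_eq _ (FractionRing (MvPowerSeries (Fin 2) ℂ)) K]
    exact (algebraMap (FractionRing (MvPowerSeries (Fin 2) ℂ)) K).injective.comp
      (IsFractionRing.injective _ _)
  have hinjA : Function.Injective (algebraMap (MvPowerSeries (Fin 2) ℂ) A) := fun a b h ↦
    hinjK (congrArg Subtype.val h)
  have : FaithfulSMul (MvPowerSeries (Fin 2) ℂ) A := (faithfulSMul_iff_algebraMap_injective _ _).2 hinjA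
  obtain ⟨φ, hφ⟩ := exists_algHom_mvPowerSeries (k := ℂ)
  let _ : Algebra ℂ A :=
    ((algebraMap (MvPowerSeries (Fin 2) ℂ) A).comp (algebraMap ℂ (MvPowerSeries (Fin 2) ℂ))).toAlgebra
  let _ : Algebra (PowerSeries ℂ) A :=
    ((algebraMap (MvPowerSeries (Fin 2) ℂ) A).comp φ.toRingHom).toAlgebra
  have : IsScalarTower ℂ (MvPowerSeries (Fin 2) ℂ) A := .of_algebraMap_eq fun _ ↦ rfl
  have : IsScalarTower ℂ (PowerSeries ℂ) A := .of_algebraMap_eq fun c ↦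
    congrArg (algebraMap (MvPowerSeries (Fin 2) ℂ) A) (φ.commutes c).symm
  have hX : (MvPowerSeries.X 0 : MvPowerSeries (Fin 2) ℂ) ≠ 0 := fun h ↦ by
    simpa using congrArg (MvPowerSeries.coeff (Finsupp.single 0 1)) h
  have hXu : ¬ IsUnit (MvPowerSeries.X 0 : MvPowerSeries (Fin 2) ℂ) := by
    simp [MvPowerSeries.isUnit_iff_constantCoeff]
  have hloc : IsLocalization.Away
    (algebraMap (MvPowerSeries (Fin 2) ℂ) A (MvPowerSeries.X 0)) R := ‹_›
  exact exists_pow_eq_adicCompletion (k := ℂ) (A := A)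
    (x := algebraMap (MvPowerSeries (Fin 2) ℂ) A (MvPowerSeries.X 0))
    (congrArg (algebraMap (MvPowerSeries (Fin 2) ℂ) A) hφ)
    ((map_ne_zero_iff _ hinjA).2 hX)
    (isSurfaceLike_of_finite (R := R) hX isSurfaceAlong_mvPowerSeries_X)
    (fun M _ ↦ algebraMap_mem_of_isMaximal hXu M) hn hf hfin v
end

section
/- Let p be a prime number and n ≥ 1. For every finite group G (with the discrete topology), every automorphism α of G, and every pair of surjective continuous group homomorphisms f, g from the additive topological group ℤ_pⁿ (the n-fold product of the ring of p-adic integers, with the product topology) to G, there exists an automorphism β of the topological group ℤ_pⁿ (a continuous group automorphism with continuous inverse) such that g ∘ β = α ∘ f. -/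
/-- Over a field, every square matrix is unit-regular. -/
theorem Matrix.exists_isUnit_mul_mul_self {m K : Type*} [Fintype m] [DecidableEq m] [Field K]
    (A : Matrix m m K) : ∃ T : Matrix m m K, IsUnit T ∧ A * T * A = A := by
  classical
  obtain ⟨L, L', D, h⟩ :=
    Matrix.Pivot.exists_list_transvec_mul_diagonal_mul_list_transvec A
  have hu (L : List (Matrix.TransvectionStruct m K)) :
      IsUnit (L.map Matrix.TransvectionStruct.toMatrix).prod := by
    simp [Matrix.isUnit_iff_isUnit_det]
  obtain ⟨U, hU⟩ := hu L
  obtain ⟨V, hV⟩ := hu L'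
  rw [← hU, ← hV] at h
  let D' : m → K := fun i => if D i = 0 then 1 else (D i)⁻¹
  have hD' : IsUnit (Matrix.diagonal D') := by
    rw [Matrix.isUnit_diagonal, Pi.isUnit_iff]
    intro i
    by_cases hi : D i = 0 <;> simp [D', hi]
  have hD : Matrix.diagonal D * Matrix.diagonal D' * Matrix.diagonal D = Matrix.diagonal D := by
    simp only [Matrix.diagonal_mul_diagonal]
    congr 1
    ext i
    by_cases hi : D i = 0 <;> simp [D', hi]
  refine ⟨V⁻¹.val * Matrix.diagonal D' * U⁻¹.val, (V⁻¹.isUnit.mul hD').mul U⁻¹.isUnit, ?_⟩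
  calc A * (V⁻¹.val * Matrix.diagonal D' * U⁻¹.val) * A
      = ↑U * (Matrix.diagonal D * Matrix.diagonal D' * Matrix.diagonal D) * ↑V := by
        simp [h, mul_assoc, -Matrix.diagonal_mul_diagonal]
    _ = A := by rw [hD, h]

/-- A ring all of whose elements are unit-regular has stable range one. -/
theorem exists_isUnit_add_one_sub_mul_mul {S : Type*} [Ring S] {a t : S} (b : S)
    (ht : IsUnit t) (h : a * t * a = a) : ∃ y, IsUnit (a + (1 - a * b) * y) := by
  obtain ⟨t, rfl⟩ := ht
  refine ⟨(1 - a * t) * ↑t⁻¹, ?_⟩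
  have key : a + (1 - a * b) * ((1 - a * t) * ↑t⁻¹) = (1 - a * b * (1 - a * t)) * ↑t⁻¹ := by
    simp only [sub_mul, mul_sub, one_mul, mul_one, mul_assoc, Units.mul_inv]
    abel
  rw [key]
  refine IsUnit.mul (IsNilpotent.isUnit_one_sub ⟨2, ?_⟩) t⁻¹.isUnit
  have h0 : (1 - a * t) * a = 0 := by rw [sub_mul, h, one_mul, sub_self]
  calc (a * b * (1 - a * t)) ^ 2 = a * b * ((1 - a * t) * a) * b * (1 - a * t) := by
        simp only [pow_two, mul_assoc]
    _ = 0 := by simp [h0]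

/-- Matrix rings over a commutative local ring have stable range one. -/
theorem Matrix.exists_isUnit_add_one_sub_mul_mul {m R : Type*} [Fintype m] [DecidableEq m]
    [CommRing R] [IsLocalRing R] (A B : Matrix m m R) :
    ∃ Y : Matrix m m R, IsUnit (A + (1 - A * B) * Y) := by
  let φ := (IsLocalRing.residue R).mapMatrix (m := m)
  obtain ⟨T, hT, h⟩ := Matrix.exists_isUnit_mul_mul_self (φ A)
  obtain ⟨Y, hY⟩ := _root_.exists_isUnit_add_one_sub_mul_mul (φ B) hT h
  choose s hs using IsLocalRing.residue_surjective (R := R)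
  have hYs : φ (Y.map s) = Y := by ext i j; simp [φ, hs]
  refine ⟨Y.map s, ?_⟩
  rw [← hYs, ← map_one φ, ← map_mul, ← map_sub, ← map_mul, ← map_add,
    Matrix.isUnit_iff_isUnit_det, ← RingHom.map_det] at hY
  rw [Matrix.isUnit_iff_isUnit_det]
  exact isUnit_of_map_unit _ _ hY

/-- A continuous homomorphism on `ℤ_pⁿ` is determined by its values on the standard basis. -/
theorem PadicInt.addMonoidHom_pi_ext {p : ℕ} [Fact p.Prime] {ι G : Type*} [Fintype ι]
    [DecidableEq ι] [AddGroup G] [TopologicalSpace G] [T2Space G] {f g : (ι → ℤ_[p]) →+ G}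
    (hf : Continuous f) (hg : Continuous g)
    (h : ∀ i, f (Pi.single i 1) = g (Pi.single i 1)) : f = g := by
  have hs (i : ι) (r : ℤ_[p]) : f (Pi.single i r) = g (Pi.single i r) := by
    have hc : Continuous (fun r : ℤ_[p] => (Pi.single i r : ι → ℤ_[p])) :=
      continuous_single (A := fun _ => ℤ_[p]) i
    refine congrFun (PadicInt.denseRange_natCast.equalizer (hf.comp hc) (hg.comp hc)
      (funext fun k => ?_)) r
    have : Pi.single i (k : ℤ_[p]) = k • (Pi.single i 1 : ι → ℤ_[p]) := by
      rw [← Pi.single_smul, nsmul_one]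
    simp only [Function.comp_apply, this, map_nsmul, h]
  ext x
  change x ∈ f.eqLocus g
  rw [← Finset.univ_sum_single x]
  exact sum_mem fun i _ => hs i (x i)

/-- Continuous homomorphisms on `ℤ_pⁿ` lift along continuous surjections. -/
theorem PadicInt.exists_matrix_comp_mulVec {p : ℕ} [Fact p.Prime] {ι G : Type*} [Fintype ι]
    [DecidableEq ι] [AddGroup G] [TopologicalSpace G] [T2Space G] {f g : (ι → ℤ_[p]) →+ G}
    (hf : Continuous f) (hg : Continuous g) (hgs : Function.Surjective g) :
    ∃ A : Matrix ι ι ℤ_[p], ∀ x, g (A.mulVec x) = f x := by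
  choose v hv using fun i => hgs (f (Pi.single i 1))
  let A : Matrix ι ι ℤ_[p] := Matrix.of fun i j => v j i
  refine ⟨A, DFunLike.congr_fun (f := g.comp A.mulVecLin.toAddMonoidHom) <|
    PadicInt.addMonoidHom_pi_ext ?_ hf fun i => ?_⟩
  · exact hg.comp (Continuous.matrix_mulVec continuous_const continuous_id)
  · have : A.mulVec (Pi.single i 1) = v i := by
      ext j
      simp [A]
    simp [this, hv]

/-- Let `p` be a prime and `n ≥ 1`. For every finite (discrete) group `G`
(written additively, which is no restriction since any quotient of `ℤ_pⁿ` is abelian),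
every automorphism `α` of `G`, and every pair of surjective continuous homomorphisms
`f, g : ℤ_pⁿ → G`, there exists an automorphism `β` of the topological group `ℤ_pⁿ`
(a continuous group automorphism with continuous inverse) such that `g ∘ β = α ∘ f`. -/
theorem stmt_8 (p : ℕ) [Fact p.Prime] (n : ℕ) (hn : 1 ≤ n)
    (G : Type) [AddGroup G] [Finite G] [TopologicalSpace G] [DiscreteTopology G]
    (α : G ≃+ G)
    (f g : (Fin n → PadicInt p) →+ G)
    (hfc : Continuous f) (hgc : Continuous g)
    (hfs : Function.Surjective f) (hgs : Function.Surjective g) :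
    ∃ β : (Fin n → PadicInt p) ≃+ (Fin n → PadicInt p),
      Continuous β ∧ Continuous β.symm ∧ ∀ x, g (β x) = α (f x) := by
  let f' : (Fin n → PadicInt p) →+ G := α.toAddMonoidHom.comp f
  have hfc' : Continuous f' := (continuous_of_discreteTopology (f := α)).comp hfc
  obtain ⟨A, hA⟩ := PadicInt.exists_matrix_comp_mulVec hfc' hgc hgs
  obtain ⟨B, hB⟩ := PadicInt.exists_matrix_comp_mulVec hgc hfc' (α.surjective.comp hfs)
  obtain ⟨Y, U, hU⟩ := Matrix.exists_isUnit_add_one_sub_mul_mul A B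
  let β : (Fin n → PadicInt p) ≃+ (Fin n → PadicInt p) :=
    { toFun := (U : Matrix _ _ _).mulVec
      invFun := (↑U⁻¹ : Matrix _ _ _).mulVec
      left_inv := fun x => by simp
      right_inv := fun x => by simp
      map_add' := Matrix.mulVec_add _ }
  refine ⟨β, Continuous.matrix_mulVec continuous_const continuous_id,
    Continuous.matrix_mulVec continuous_const continuous_id, fun x => ?_⟩
  change g ((U : Matrix _ _ _).mulVec x) = f' x
  rw [hU, Matrix.add_mulVec, map_add, hA, ← Matrix.mulVec_mulVec, Matrix.sub_mulVec,
    Matrix.one_mulVec, ← Matrix.mulVec_mulVec, map_sub, hA, hB, sub_self, add_zero]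
end

section
/- Let n ≥ 1 and let Ẑ := ∏_p ℤ_p denote the product over all prime numbers p of the rings of p-adic integers, with the product topology, so that Ẑⁿ is a profinite additive topological group. Then Ẑⁿ has enough automorphisms: for every finite group G (with the discrete topology), every automorphism α of G, and every pair of surjective continuous group homomorphisms f, g : Ẑⁿ → G, there exists an automorphism β of the topological group Ẑⁿ (a continuous group automorphism with continuous inverse) such that g ∘ β = α ∘ f. -/
instance (p : Nat.Primes) : Fact (Nat.Prime (p : ℕ)) := ⟨p.2⟩

/-- The endomorphism ring of a finite-dimensional vector space has stable range one. -/
theorem Module.End.exists_isUnit_add_mul {K V : Type*} [Field K] [AddCommGroup V] [Module K V]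
    [FiniteDimensional K V] {A B C : Module.End K V} (h : A * B + C = 1) :
    ∃ Y : Module.End K V, IsUnit (A + C * Y) := by
  obtain ⟨U, hdisj, hsup⟩ := IsModularLattice.exists_disjoint_and_sup_eq
    (inf_le_right : LinearMap.range A ⊓ LinearMap.range C ≤ LinearMap.range C)
  have hUC : U ≤ LinearMap.range C := hsup ▸ le_sup_right
  have hAU : IsCompl (LinearMap.range A) U := by
    constructor
    · rw [Submodule.disjoint_def] at hdisj ⊢
      exact fun x hA hU => hdisj x ⟨hA, hUC hU⟩ hU
    · rw [codisjoint_iff, eq_top_iff]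
      intro x _
      have hx : x = A (B x) + C x := by
        simpa using (LinearMap.congr_fun h x).symm
      have hC : LinearMap.range C ≤ LinearMap.range A ⊔ U :=
        hsup ▸ sup_le_sup_right inf_le_left U
      rw [hx]
      exact add_mem (Submodule.mem_sup_left ⟨_, rfl⟩) (hC ⟨_, rfl⟩)
  have hrank : Module.finrank K (LinearMap.ker A) = Module.finrank K U := by
    have h1 := A.finrank_range_add_finrank_ker
    have h2 := Submodule.finrank_add_eq_of_isCompl hAU
    omega
  let e : LinearMap.ker A ≃ₗ[K] U := LinearEquiv.ofFinrankEq _ _ hrank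
  obtain ⟨r, hr⟩ := C.rangeRestrict.exists_rightInverse_of_surjective C.range_rangeRestrict
  have hCr (y : LinearMap.range C) : C (r y) = y := congrArg Subtype.val (LinearMap.congr_fun hr y)
  obtain ⟨W, hW⟩ := (LinearMap.ker A).exists_isCompl
  let Y : Module.End K V :=
    LinearMap.ofIsCompl hW (r ∘ₗ Submodule.inclusion hUC ∘ₗ e.toLinearMap) 0
  refine ⟨Y, (LinearMap.isUnit_iff_ker_eq_bot _).2 ((Submodule.eq_bot_iff _).2 fun x hx => ?_)⟩
  obtain ⟨k, hk, w, hw, rfl⟩ := Submodule.mem_sup.1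
    (hW.sup_eq_top ▸ Submodule.mem_top : x ∈ LinearMap.ker A ⊔ W)
  have hYk : C (Y k) = e ⟨k, hk⟩ := by
    have : Y k = r (Submodule.inclusion hUC (e ⟨k, hk⟩)) :=
      LinearMap.ofIsCompl_apply_left hW ⟨k, hk⟩
    rw [this, hCr]
    rfl
  have hYw : Y w = 0 := LinearMap.ofIsCompl_apply_right hW ⟨w, hw⟩
  have hsum : A w + e ⟨k, hk⟩ = 0 := by
    have hAk : A k = 0 := hk
    simpa [hAk, hYk, hYw] using hx
  have hAw : A w = 0 := (Submodule.disjoint_def.1 hAU.disjoint) _ ⟨w, rfl⟩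
    (eq_neg_of_add_eq_zero_left hsum ▸ neg_mem (e ⟨k, hk⟩).2)
  have hw0 : w = 0 := (Submodule.disjoint_def.1 hW.disjoint) w hAw hw
  have hk0 : (⟨k, hk⟩ : LinearMap.ker A) = 0 := by
    rw [hAw, zero_add] at hsum
    exact e.map_eq_zero_iff.1 (Subtype.ext hsum)
  rw [hw0, add_zero]
  exact congrArg Subtype.val hk0

/-- Square matrices over a field have stable range one. -/
theorem Matrix.exists_isUnit_add_mul {K ι : Type*} [Field K] [Fintype ι] [DecidableEq ι]
    {A B C : Matrix ι ι K} (h : A * B + C = 1) : ∃ Y : Matrix ι ι K, IsUnit (A + C * Y) := by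
  have h' : (toLinAlgEquiv' A : Module.End K (ι → K)) * toLinAlgEquiv' B + toLinAlgEquiv' C = 1 := by
    rw [← map_mul, ← map_add, h, map_one]
  obtain ⟨Y, hY⟩ := Module.End.exists_isUnit_add_mul h'
  refine ⟨toLinAlgEquiv'.symm Y, ?_⟩
  have := hY.map (toLinAlgEquiv' (R := K) (n := ι)).symm
  simpa using this

/-- Square matrices over a product of rings, each with a surjective local homomorphism onto a
field, have stable range one. -/
theorem Matrix.exists_isUnit_add_mul_of_pi {ι P : Type*} [Fintype ι] [DecidableEq ι]
    {R k : P → Type*} [∀ p, CommRing (R p)] [∀ p, Field (k p)] (φ : ∀ p, R p →+* k p)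
    [∀ p, IsLocalHom (φ p)] (hφ : ∀ p, Function.Surjective (φ p))
    {A B C : Matrix ι ι (∀ p, R p)} (h : A * B + C = 1) :
    ∃ Y : Matrix ι ι (∀ p, R p), IsUnit (A + C * Y) := by
  let ψ (p : P) : (∀ p, R p) →+* k p := (φ p).comp (Pi.evalRingHom R p)
  have hψ (p : P) : (ψ p).mapMatrix A * (ψ p).mapMatrix B + (ψ p).mapMatrix C
      = (1 : Matrix ι ι (k p)) := by
    rw [← map_mul, ← map_add, h, map_one]
  choose Z hZ using fun p => Matrix.exists_isUnit_add_mul (hψ p)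
  choose s hs using hφ
  let Y : Matrix ι ι (∀ p, R p) := Matrix.of fun i j p => s p (Z p i j)
  have hY (p : P) : (ψ p).mapMatrix Y = Z p := by
    ext i j
    exact hs p _
  refine ⟨Y, (Matrix.isUnit_iff_isUnit_det _).2 (Pi.isUnit_iff.2 fun p => ?_)⟩
  have hu := (Matrix.isUnit_iff_isUnit_det _).1 (hZ p)
  rw [← hY p, ← map_mul, ← map_add, ← RingHom.map_det] at hu
  exact isUnit_of_map_unit (φ p) _ hu

instance PadicInt.isLocalHom_toZMod (p : ℕ) [Fact p.Prime] :
    IsLocalHom (PadicInt.toZMod : ℤ_[p] →+* ZMod p) where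
  map_nonunit a ha := by
    by_contra hn
    have hm : a ∈ RingHom.ker (PadicInt.toZMod : ℤ_[p] →+* ZMod p) :=
      PadicInt.ker_toZMod (p := p) ▸ hn
    rw [RingHom.mem_ker] at hm
    exact ha.ne_zero hm

/-- Every element of `∏ p, ℤ_p` is congruent to a natural number modulo any `N ≠ 0`. -/
theorem PadicInt.exists_pi_eq_natCast_add_mul {N : ℕ} (hN : N ≠ 0)
    (r : ∀ p : Nat.Primes, PadicInt p) :
    ∃ (k : ℕ) (s : ∀ p : Nat.Primes, PadicInt p), r = k + N * s := by
  induction N using induction_on_primes generalizing r with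
  | zero => exact absurd rfl hN
  | one => exact ⟨0, r, by simp⟩
  | prime_mul p N hp ih =>
    obtain ⟨k, s, rfl⟩ := ih (right_ne_zero_of_mul hN) r
    obtain ⟨P, rfl⟩ : ∃ P : Nat.Primes, (P : ℕ) = p := ⟨⟨p, hp⟩, rfl⟩
    have hdvd : ∃ k' : ℕ, ∀ q : Nat.Primes, ((P : ℕ) : PadicInt q) ∣ s q - k' := by
      refine ⟨(s P).zmodRepr, fun q => ?_⟩
      by_cases hq : q = P
      · subst hq
        have := PadicInt.sub_zmodRepr_mem (s q)
        rwa [PadicInt.maximalIdeal_eq_span_p, Ideal.mem_span_singleton] at this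
      · refine IsUnit.dvd (PadicInt.isUnit_iff.2 ?_)
        refine PadicInt.norm_natCast_eq_one_iff.2 ?_
        exact (Nat.coprime_primes q.2 hp).2 fun h => hq (Subtype.ext h)
    obtain ⟨k', hk'⟩ := hdvd
    choose t ht using hk'
    refine ⟨k + N * k', t, ?_⟩
    funext q
    have := ht q
    simp only [Pi.add_apply, Pi.mul_apply, Pi.natCast_apply, Nat.cast_add, Nat.cast_mul]
    linear_combination (N : PadicInt q) * this

/-- If two homomorphisms from `∏ p, ℤ_p`-modules to a finite group take the same value at `x` and
`y`, then they take the same value at `r • x` and `r • y` for every scalar `r`. -/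
theorem PadicInt.map_pi_smul_eq {M M' G : Type*} [AddCommGroup M] [AddCommGroup M'] [AddGroup G]
    [Finite G] [Module (∀ p : Nat.Primes, PadicInt p) M] [Module (∀ p : Nat.Primes, PadicInt p) M']
    (f : M →+ G) (g : M' →+ G) {x : M} {y : M'} (h : f x = g y)
    (r : ∀ p : Nat.Primes, PadicInt p) : f (r • x) = g (r • y) := by
  obtain ⟨k, s, rfl⟩ := PadicInt.exists_pi_eq_natCast_add_mul (Nat.card_pos (α := G)).ne' r
  simp only [add_smul, mul_smul, Nat.cast_smul_eq_nsmul, map_add, map_nsmul, h,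
    card_nsmul_eq_zero']

/-- A homomorphism from a free `∏ p, ℤ_p`-module to a finite group lifts along a surjective one to
a linear map given by a matrix. -/
theorem PadicInt.exists_matrix_lift {ι G : Type*} [Fintype ι] [DecidableEq ι] [AddCommGroup G]
    [Finite G] (f g : (ι → ∀ p : Nat.Primes, PadicInt p) →+ G) (hg : Function.Surjective g) :
    ∃ A : Matrix ι ι (∀ p : Nat.Primes, PadicInt p), ∀ x, g (A.mulVec x) = f x := by
  choose a ha using fun j => hg (f (Pi.single j 1))
  refine ⟨Matrix.of fun i j => a j i, fun x => ?_⟩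
  have hA : (Matrix.of fun i j => a j i).mulVec x = ∑ j, x j • a j := by
    simp [Matrix.mulVec_eq_sum, Matrix.transpose, funext_iff]
  conv_rhs => rw [pi_eq_sum_univ' x]
  rw [hA, map_sum, map_sum]
  exact Finset.sum_congr rfl fun j _ => PadicInt.map_pi_smul_eq g f (ha j) (x j)

/-- Two surjections from a free `∏ p, ℤ_p`-module of finite rank onto a finite abelian group differ
by an invertible matrix. -/
theorem PadicInt.exists_isUnit_matrix_lift {ι G : Type*} [Fintype ι] [DecidableEq ι]
    [AddCommGroup G] [Finite G] (f g : (ι → ∀ p : Nat.Primes, PadicInt p) →+ G)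
    (hf : Function.Surjective f) (hg : Function.Surjective g) :
    ∃ A : Matrix ι ι (∀ p : Nat.Primes, PadicInt p), IsUnit A ∧ ∀ x, g (A.mulVec x) = f x := by
  obtain ⟨A, hA⟩ := PadicInt.exists_matrix_lift f g hg
  obtain ⟨B, hB⟩ := PadicInt.exists_matrix_lift g f hf
  obtain ⟨Y, hY⟩ := Matrix.exists_isUnit_add_mul_of_pi
    (fun p : Nat.Primes => (PadicInt.toZMod : PadicInt p →+* ZMod p))
    (fun p => ZMod.ringHom_surjective _) (add_sub_cancel (A * B) 1)
  refine ⟨_, hY, fun x => ?_⟩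
  rw [Matrix.add_mulVec, ← Matrix.mulVec_mulVec, Matrix.sub_mulVec, Matrix.one_mulVec,
    ← Matrix.mulVec_mulVec, map_add, map_sub, hA, hA, hB, sub_self, add_zero]



/-- Let `n ≥ 1` and let `Ẑ := ∏_p ℤ_p` (product over all primes, with the
product topology). Then `Ẑⁿ` has enough automorphisms: for every finite (discrete) group
`G` (written additively, which is no restriction since any quotient of `Ẑⁿ` is abelian),
every automorphism `α` of `G`, and every pair of surjective continuous homomorphisms
`f, g : Ẑⁿ → G`, there exists an automorphism `β` of the topological group `Ẑⁿ`
(a continuous group automorphism with continuous inverse) such that `g ∘ β = α ∘ f`. -/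
theorem stmt_9 (n : ℕ) (hn : 1 ≤ n)
    (G : Type) [AddGroup G] [Finite G] [TopologicalSpace G] [DiscreteTopology G]
    (α : G ≃+ G)
    (f g : (Fin n → ∀ p : Nat.Primes, PadicInt p) →+ G)
    (hfc : Continuous f) (hgc : Continuous g)
    (hfs : Function.Surjective f) (hgs : Function.Surjective g) :
    ∃ β : (Fin n → ∀ p : Nat.Primes, PadicInt p) ≃+ (Fin n → ∀ p : Nat.Primes, PadicInt p),
      Continuous β ∧ Continuous β.symm ∧ ∀ x, g (β x) = α (f x) := by
  let _ : AddCommGroup G :=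
    { ‹AddGroup G› with
      add_comm := fun a b => by
        obtain ⟨x, rfl⟩ := hfs a
        obtain ⟨y, rfl⟩ := hfs b
        rw [← map_add, ← map_add, add_comm] }
  obtain ⟨A, ⟨u, rfl⟩, hA⟩ := PadicInt.exists_isUnit_matrix_lift
    ((α : G →+ G).comp f) g (α.surjective.comp hfs) hgs
  refine ⟨⟨⟨u.1.mulVec, u⁻¹.1.mulVec, fun x => ?_, fun x => ?_⟩, u.1.mulVec_add⟩, ?_, ?_, hA⟩
  · rw [Matrix.mulVec_mulVec, Units.inv_mul, Matrix.one_mulVec]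
  · rw [Matrix.mulVec_mulVec, Units.mul_inv, Matrix.one_mulVec]
  · exact continuous_const.matrix_mulVec continuous_id
  · exact continuous_const.matrix_mulVec continuous_id
end
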